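/- The fixed ring D^η = {r ∈ D : η(r) = r} is isomorphic to D = k_q(x,y) as a k-algebra (for the same q). -/

import Mathlib

/-- `D`, together with the distinguished nonzero elements `x`, `y` satisfying
`x * y = q • (y * x)`, is the `q`-division ring `k_q(x,y)`: the Ore division ring of fractions
of the quantum plane `k_q[x,y]`.  The quantum plane sits inside `D` as the `k`-subalgebra
generated by `x` and `y`; linear independence of the monomials `yⁱxʲ` says that this subalgebra
really is the quantum plane, and `exists_frac` says that `D` is its ring of (left) fractions. -/
structure IsQDivisionRing (k : Type*) [Field k] (D : Type*) [DivisionRing D] [Algebra k D]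
    (q : k) (x y : D) : Prop where
  x_ne_zero : x ≠ 0
  y_ne_zero : y ≠ 0
  rel : x * y = algebraMap k D q * (y * x)
  monomials_linearIndependent :
    LinearIndependent k fun p : ℕ × ℕ => y ^ p.1 * x ^ p.2
  exists_frac : ∀ d : D, ∃ s t : D, s ∈ Algebra.adjoin k ({x, y} : Set D) ∧
    t ∈ Algebra.adjoin k ({x, y} : Set D) ∧ t ≠ 0 ∧ d = t⁻¹ * s

namespace QDivision

section Monomials

variable {k R : Type*} [Field k] [Ring R] [Algebra k R] {q : k} {f g : R}

/-- The ordered monomials in a pair of elements `f, g`. -/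
def mon (f g : R) (p : ℕ × ℕ) : R := g ^ p.1 * f ^ p.2

theorem pow_mul_pow_of_rel (h : f * g = q • (g * f)) (m n : ℕ) :
    f ^ m * g ^ n = q ^ (m * n) • (g ^ n * f ^ m) := by
  have h1 : ∀ n : ℕ, f * g ^ n = q ^ n • (g ^ n * f) := by
    intro n
    induction n with
    | zero => simp
    | succ n ih =>
      rw [pow_succ, ← mul_assoc, ih, smul_mul_assoc, mul_assoc, h, mul_smul_comm, smul_smul,
        ← mul_assoc, pow_succ]
  induction m with
  | zero => simp
  | succ m ih =>
    rw [pow_succ, mul_assoc, h1, mul_smul_comm, ← mul_assoc, ih, smul_mul_assoc, smul_smul,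
      mul_assoc, add_mul, one_mul, pow_add, mul_comm]

theorem mon_mul_mon (h : f * g = q • (g * f)) (p p' : ℕ × ℕ) :
    mon f g p * mon f g p' = q ^ (p.2 * p'.1) • mon f g (p + p') := by
  simp only [mon, Prod.fst_add, Prod.snd_add, pow_add]
  calc g ^ p.1 * f ^ p.2 * (g ^ p'.1 * f ^ p'.2)
      = g ^ p.1 * (f ^ p.2 * g ^ p'.1) * f ^ p'.2 := by simp only [mul_assoc]
    _ = _ := by
      rw [pow_mul_pow_of_rel h]
      simp only [mul_assoc, smul_mul_assoc, mul_smul_comm]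

theorem adjoin_eq_span (h : f * g = q • (g * f)) :
    (Algebra.adjoin k {f, g}).toSubmodule = Submodule.span k (Set.range (mon f g)) := by
  apply le_antisymm
  · intro a ha
    induction ha using Algebra.adjoin_induction with
    | mem a ha =>
      rcases ha with rfl | rfl
      · exact Submodule.subset_span ⟨(0, 1), by simp [mon]⟩
      · exact Submodule.subset_span ⟨(1, 0), by simp [mon]⟩
    | algebraMap c =>
      rw [Algebra.algebraMap_eq_smul_one]
      exact Submodule.smul_mem _ _ (Submodule.subset_span ⟨(0, 0), by simp [mon]⟩)
    | add a b _ _ ha hb => exact add_mem ha hb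
    | mul a b ha' hb' ha hb =>
      clear ha' hb'
      induction ha, hb using Submodule.span_induction₂ with
      | mem_mem a b ha hb =>
        obtain ⟨p, rfl⟩ := ha
        obtain ⟨p', rfl⟩ := hb
        rw [mon_mul_mon h]
        exact Submodule.smul_mem _ _ (Submodule.subset_span ⟨_, rfl⟩)
      | zero_left => simp
      | zero_right => simp
      | add_left a b c _ _ _ h1 h2 => rw [add_mul]; exact add_mem h1 h2
      | add_right a b c _ _ _ h1 h2 => rw [mul_add]; exact add_mem h1 h2
      | smul_left c a b _ _ h1 => rw [smul_mul_assoc]; exact Submodule.smul_mem _ _ h1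
      | smul_right c a b _ _ h1 => rw [mul_smul_comm]; exact Submodule.smul_mem _ _ h1
  · rw [Submodule.span_le]
    rintro _ ⟨p, rfl⟩
    exact (Subalgebra.mem_toSubmodule _).2 (mul_mem (pow_mem (Algebra.subset_adjoin (by simp)) _)
      (pow_mem (Algebra.subset_adjoin (by simp)) _))

theorem mem_adjoin_iff (h : f * g = q • (g * f)) {a : R} :
    a ∈ Algebra.adjoin k {f, g} ↔ ∃ c : ℕ × ℕ →₀ k, c.sum (fun p t => t • mon f g p) = a := by
  rw [← Subalgebra.mem_toSubmodule, adjoin_eq_span h, Finsupp.mem_span_range_iff_exists_finsupp]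

end Monomials

section Ore

variable {k D : Type*} [Field k] [DivisionRing D] [Algebra k D] {q : k} {x y : D}

theorem _root_.IsQDivisionRing.rel_smul (hD : IsQDivisionRing k D q x y) :
    x * y = q • (y * x) := by
  rw [hD.rel, Algebra.smul_def]

theorem exists_common_left_multiple (hD : IsQDivisionRing k D q x y) (s : D) {t : D}
    (ht : t ≠ 0) : ∃ a b : D, a ∈ Algebra.adjoin k {x, y} ∧ b ∈ Algebra.adjoin k {x, y} ∧
      a ≠ 0 ∧ a * s = b * t := by
  obtain ⟨b, a, hb, ha, ha0, h⟩ := hD.exists_frac (s * t⁻¹)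
  refine ⟨a, b, ha, hb, ha0, ?_⟩
  have hs : s = a⁻¹ * b * t := by rw [← h, inv_mul_cancel_right₀ ht]
  rw [hs, mul_assoc a⁻¹, mul_inv_cancel_left₀ ha0]

theorem subfield_eq_top (hD : IsQDivisionRing k D q x y) (S : Subfield D)
    (hS : ∀ c : k, algebraMap k D c ∈ S) (hx : x ∈ S) (hy : y ∈ S) (d : D) : d ∈ S := by
  have key : ∀ a ∈ Algebra.adjoin k {x, y}, a ∈ S := by
    intro a ha
    induction ha using Algebra.adjoin_induction with
    | mem a ha => rcases ha with rfl | rfl <;> assumption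
    | algebraMap c => exact hS c
    | add a b _ _ ha hb => exact add_mem ha hb
    | mul a b _ _ ha hb => exact mul_mem ha hb
  obtain ⟨s, t, hs, ht, -, rfl⟩ := hD.exists_frac d
  exact mul_mem (inv_mem (key t ht)) (key s hs)

end Ore

section Lead

open WithZero

variable {k D : Type*} [Field k] [DivisionRing D] [Algebra k D] {q : k} {x y : D}

/-- The degree of the monomial `yⁱxʲ`, ordered lexicographically. -/
def deg (p : ℕ × ℕ) : ℤ ×ₗ ℤ := toLex ((p.1 : ℤ), (p.2 : ℤ))

theorem deg_add (p p' : ℕ × ℕ) : deg (p + p') = deg p + deg p' := by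
  apply ofLex.injective
  simp [deg]

theorem deg_injective : Function.Injective deg := by
  intro p p' h
  have := congrArg ofLex h
  simpa [deg, Prod.ext_iff] using this

/-- The span of the monomials of degree less than `γ`. -/
def lower (k : Type*) {D : Type*} [Field k] [DivisionRing D] [Algebra k D] (x y : D)
    (γ : ℤ ×ₗ ℤ) : Submodule k D :=
  Submodule.span k (mon x y '' {p | deg p < γ})

/-- `s` has a leading monomial, and the degree of that monomial is `γ`. -/
def Lead (k : Type*) {D : Type*} [Field k] [DivisionRing D] [Algebra k D] (x y s : D)
    (γ : ℤ ×ₗ ℤ) : Prop :=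
  ∃ (p : ℕ × ℕ) (c : k) (r : D), c ≠ 0 ∧ γ = deg p ∧ r ∈ lower k x y γ ∧ s = c • mon x y p + r

theorem lower_mono {γ γ' : ℤ ×ₗ ℤ} (h : γ ≤ γ') : lower k x y γ ≤ lower k x y γ' :=
  Submodule.span_mono (Set.image_mono fun _ hp => lt_of_lt_of_le hp h)

theorem mon_mem_lower {p : ℕ × ℕ} {γ : ℤ ×ₗ ℤ} (h : deg p < γ) : mon x y p ∈ lower k x y γ :=
  Submodule.subset_span ⟨p, h, rfl⟩

theorem Lead.mem_lower {s : D} {γ γ' : ℤ ×ₗ ℤ} (h : Lead k x y s γ) (hγ : γ < γ') :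
    s ∈ lower k x y γ' := by
  obtain ⟨p, c, r, -, rfl, hr, rfl⟩ := h
  exact add_mem (Submodule.smul_mem _ _ (mon_mem_lower hγ)) (lower_mono hγ.le hr)

theorem Lead.notMem_lower (hD : IsQDivisionRing k D q x y) {s : D} {γ : ℤ ×ₗ ℤ}
    (h : Lead k x y s γ) : s ∉ lower k x y γ := by
  obtain ⟨p, c, r, hc, rfl, hr, rfl⟩ := h
  intro hs
  have h1 : mon x y p ∈ lower k x y (deg p) := by
    have := Submodule.smul_mem _ c⁻¹ (sub_mem hs hr)
    rwa [add_sub_cancel_right, smul_smul, inv_mul_cancel₀ hc, one_smul] at this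
  exact hD.monomials_linearIndependent.notMem_span_image
    (s := {p' | deg p' < deg p}) (x := p) (by simp) h1

theorem Lead.ne_zero (hD : IsQDivisionRing k D q x y) {s : D} {γ : ℤ ×ₗ ℤ}
    (h : Lead k x y s γ) : s ≠ 0 := by
  rintro rfl
  exact h.notMem_lower hD (zero_mem _)

theorem Lead.unique (hD : IsQDivisionRing k D q x y) {s : D} {γ γ' : ℤ ×ₗ ℤ}
    (h : Lead k x y s γ) (h' : Lead k x y s γ') : γ = γ' := by
  rcases lt_trichotomy γ γ' with hlt | rfl | hlt
  · exact absurd (h.mem_lower hlt) (h'.notMem_lower hD)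
  · rfl
  · exact absurd (h'.mem_lower hlt) (h.notMem_lower hD)

theorem Lead.mem_adjoin {s : D} {γ : ℤ ×ₗ ℤ}
    (h : Lead k x y s γ) : s ∈ Algebra.adjoin k {x, y} := by
  have hm : ∀ p, mon x y p ∈ Algebra.adjoin k {x, y} := fun p =>
    mul_mem (pow_mem (Algebra.subset_adjoin (by simp)) _)
      (pow_mem (Algebra.subset_adjoin (by simp)) _)
  obtain ⟨p, c, r, -, rfl, hr, rfl⟩ := h
  refine add_mem (Subalgebra.smul_mem _ (hm p) c) ?_
  have : lower k x y (deg p) ≤ (Algebra.adjoin k {x, y}).toSubmodule := by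
    rw [lower, Submodule.span_le]
    rintro _ ⟨p', -, rfl⟩
    exact hm p'
  exact this hr

theorem exists_lead (hD : IsQDivisionRing k D q x y) {s : D}
    (hs : s ∈ Algebra.adjoin k {x, y}) (hs0 : s ≠ 0) : ∃ γ, Lead k x y s γ := by
  classical
  obtain ⟨c, rfl⟩ := (mem_adjoin_iff hD.rel_smul).1 hs
  have hc : c.support.Nonempty := by
    rw [Finsupp.support_nonempty_iff]
    rintro rfl
    simp at hs0
  obtain ⟨p, hp, hmax⟩ := Finset.exists_max_image c.support deg hc
  refine ⟨deg p, p, c p, ∑ p' ∈ c.support.erase p, c p' • mon x y p',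
    Finsupp.mem_support_iff.1 hp, rfl, ?_, ?_⟩
  · refine Submodule.sum_mem _ fun p' hp' => Submodule.smul_mem _ _ (mon_mem_lower ?_)
    rw [Finset.mem_erase] at hp'
    exact lt_of_le_of_ne (hmax p' hp'.2) fun h => hp'.1 (deg_injective h)
  · exact (Finset.add_sum_erase _ (fun p' => c p' • mon x y p') hp).symm

theorem mul_mem_lower (hD : IsQDivisionRing k D q x y) {γ γ' : ℤ ×ₗ ℤ}
    {r r' : D} {P P' : Set (ℕ × ℕ)}
    (hr : r ∈ Submodule.span k (mon x y '' P)) (hr' : r' ∈ Submodule.span k (mon x y '' P'))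
    (hP : ∀ p ∈ P, ∀ p' ∈ P', deg p + deg p' < γ + γ') : r * r' ∈ lower k x y (γ + γ') := by
  have h := Submodule.mul_mem_mul hr hr'
  rw [Submodule.span_mul_span] at h
  refine Submodule.span_le.2 ?_ h
  rintro _ ⟨_, ⟨p, hp, rfl⟩, _, ⟨p', hp', rfl⟩, rfl⟩
  simp only [mon_mul_mon hD.rel_smul]
  refine Submodule.smul_mem _ _ (mon_mem_lower ?_)
  rw [deg_add]
  exact hP p hp p' hp'

theorem Lead.mul (hD : IsQDivisionRing k D q x y) (hq : q ≠ 0) {s s' : D} {γ γ' : ℤ ×ₗ ℤ}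
    (h : Lead k x y s γ) (h' : Lead k x y s' γ') : Lead k x y (s * s') (γ + γ') := by
  obtain ⟨p, c, r, hc, rfl, hr, rfl⟩ := h
  obtain ⟨p', c', r', hc', rfl, hr', rfl⟩ := h'
  have hm : ∀ p, mon x y p ∈ Submodule.span k (mon x y '' {p}) := fun p =>
    Submodule.subset_span ⟨p, rfl, rfl⟩
  refine ⟨p + p', c * c' * q ^ (p.2 * p'.1),
    c • (mon x y p * r') + c' • (r * mon x y p') + r * r',
    mul_ne_zero (mul_ne_zero hc hc') (pow_ne_zero _ hq), (deg_add p p').symm, ?_, ?_⟩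
  · refine add_mem (add_mem (Submodule.smul_mem _ _ ?_) (Submodule.smul_mem _ _ ?_)) ?_
    · refine mul_mem_lower hD (hm p) hr' ?_
      rintro _ rfl p' hp'
      exact add_lt_add_right hp' _
    · refine mul_mem_lower hD hr (hm p') ?_
      rintro p hp _ rfl
      exact add_lt_add_left hp _
    · exact mul_mem_lower hD hr hr' fun p hp p' hp' => add_lt_add hp hp'
  · rw [mul_smul, mul_smul, ← mon_mul_mon hD.rel_smul]
    simp only [add_mul, mul_add, smul_mul_assoc, mul_smul_comm, smul_smul, smul_add]
    rw [mul_comm c' c]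
    abel

theorem Lead.add_le (hD : IsQDivisionRing k D q x y) {s s' : D} {γ γ' : ℤ ×ₗ ℤ}
    (h : Lead k x y s γ) (h' : Lead k x y s' γ') (h0 : s + s' ≠ 0) :
    ∃ γ'' ≤ max γ γ', Lead k x y (s + s') γ'' := by
  obtain ⟨γ'', h''⟩ := exists_lead hD (add_mem h.mem_adjoin h'.mem_adjoin) h0
  refine ⟨γ'', le_of_not_gt fun hlt => h''.notMem_lower hD ?_, h''⟩
  rw [max_lt_iff] at hlt
  exact add_mem (h.mem_lower hlt.1) (h'.mem_lower hlt.2)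

/-- `γ` is the degree of the fraction `d`. -/
def FracDeg (k : Type*) {D : Type*} [Field k] [DivisionRing D] [Algebra k D] (x y d : D)
    (γ : ℤ ×ₗ ℤ) : Prop :=
  ∃ (s t : D) (a b : ℤ ×ₗ ℤ), Lead k x y s a ∧ Lead k x y t b ∧ t * d = s ∧ γ = a - b

theorem FracDeg.ne_zero (hD : IsQDivisionRing k D q x y) {d : D} {γ : ℤ ×ₗ ℤ}
    (h : FracDeg k x y d γ) : d ≠ 0 := by
  obtain ⟨s, t, a, b, hs, ht, e, rfl⟩ := h
  rintro rfl
  exact hs.ne_zero hD (by rw [← e, mul_zero])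

theorem exists_fracDeg (hD : IsQDivisionRing k D q x y) {d : D} (hd : d ≠ 0) :
    ∃ γ, FracDeg k x y d γ := by
  obtain ⟨s, t, hs, ht, ht0, rfl⟩ := hD.exists_frac d
  have hs0 : s ≠ 0 := by
    rintro rfl
    simp at hd
  obtain ⟨a, ha⟩ := exists_lead hD hs hs0
  obtain ⟨b, hb⟩ := exists_lead hD ht ht0
  exact ⟨a - b, s, t, a, b, ha, hb, mul_inv_cancel_left₀ ht0 s, rfl⟩

theorem exists_lead_multiple (hD : IsQDivisionRing k D q x y) {s t : D} (hs : s ≠ 0)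
    (ht : t ≠ 0) : ∃ (u v : D) (a b : ℤ ×ₗ ℤ), Lead k x y u a ∧ Lead k x y v b ∧
      u * s = v * t := by
  obtain ⟨u, v, hu, hv, hu0, e⟩ := exists_common_left_multiple hD s ht
  have hv0 : v ≠ 0 := by
    rintro rfl
    rw [zero_mul] at e
    exact mul_ne_zero hu0 hs e
  obtain ⟨a, ha⟩ := exists_lead hD hu hu0
  obtain ⟨b, hb⟩ := exists_lead hD hv hv0
  exact ⟨u, v, a, b, ha, hb, e⟩

theorem FracDeg.unique (hD : IsQDivisionRing k D q x y) (hq : q ≠ 0) {d : D} {γ γ' : ℤ ×ₗ ℤ}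
    (h : FracDeg k x y d γ) (h' : FracDeg k x y d γ') : γ = γ' := by
  obtain ⟨s, t, a, b, hs, ht, e, rfl⟩ := h
  obtain ⟨s', t', a', b', hs', ht', e', rfl⟩ := h'
  obtain ⟨u, v, m, n, hu, hv, huv⟩ := exists_lead_multiple hD (ht.ne_zero hD) (ht'.ne_zero hD)
  have h1 : m + b = n + b' :=
    (hu.mul hD hq ht).unique hD (huv ▸ hv.mul hD hq ht')
  have h2 : m + a = n + a' := by
    refine (hu.mul hD hq hs).unique hD ?_
    rw [← e, ← mul_assoc, huv, mul_assoc, e']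
    exact hv.mul hD hq hs'
  have h3 : a = n + a' - m := by rw [← h2]; abel
  have h4 : b = n + b' - m := by rw [← h1]; abel
  rw [h3, h4]
  abel

theorem FracDeg.mul (hD : IsQDivisionRing k D q x y) (hq : q ≠ 0) {d d' : D} {γ γ' : ℤ ×ₗ ℤ}
    (h : FracDeg k x y d γ) (h' : FracDeg k x y d' γ') : FracDeg k x y (d * d') (γ + γ') := by
  obtain ⟨s, t, a, b, hs, ht, e, rfl⟩ := h
  obtain ⟨s', t', a', b', hs', ht', e', rfl⟩ := h'
  obtain ⟨u, v, m, n, hu, hv, huv⟩ := exists_lead_multiple hD (hs.ne_zero hD) (ht'.ne_zero hD)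
  have h1 : m + a = n + b' :=
    (hu.mul hD hq hs).unique hD (huv ▸ hv.mul hD hq ht')
  refine ⟨v * s', u * t, _, _, hv.mul hD hq hs', hu.mul hD hq ht, ?_, ?_⟩
  · rw [mul_assoc u, ← mul_assoc t, e, ← mul_assoc, huv, mul_assoc, e']
  · have h2 : a = n + b' - m := by rw [← h1]; abel
    rw [h2]
    abel

theorem FracDeg.add_le (hD : IsQDivisionRing k D q x y) (hq : q ≠ 0) {d d' : D}
    {γ γ' : ℤ ×ₗ ℤ} (h : FracDeg k x y d γ) (h' : FracDeg k x y d' γ') (h0 : d + d' ≠ 0) :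
    ∃ γ'' ≤ max γ γ', FracDeg k x y (d + d') γ'' := by
  obtain ⟨s, t, a, b, hs, ht, e, rfl⟩ := h
  obtain ⟨s', t', a', b', hs', ht', e', rfl⟩ := h'
  obtain ⟨u, v, m, n, hu, hv, huv⟩ := exists_lead_multiple hD (ht.ne_zero hD) (ht'.ne_zero hD)
  have h1 : m + b = n + b' :=
    (hu.mul hD hq ht).unique hD (huv ▸ hv.mul hD hq ht')
  have hsum : u * t * (d + d') = u * s + v * s' := by
    rw [mul_add, mul_assoc, e, huv, mul_assoc, e']
  have hut := hu.mul hD hq ht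
  have hne : u * s + v * s' ≠ 0 := hsum ▸ mul_ne_zero (hut.ne_zero hD) h0
  obtain ⟨c, hc, hlead⟩ := (hu.mul hD hq hs).add_le hD (hv.mul hD hq hs') hne
  refine ⟨c - (m + b), ?_, _, _, _, _, hlead, hut, hsum, rfl⟩
  rw [sub_le_iff_le_add]
  refine hc.trans (max_le ?_ ?_)
  · have : m + a = a - b + (m + b) := by abel
    rw [this]
    exact add_le_add_left (le_max_left _ _) _
  · have : n + a' = a' - b' + (m + b) := by rw [h1]; abel
    rw [this]
    exact add_le_add_left (le_max_right _ _) _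

theorem exists_valuation (hD : IsQDivisionRing k D q x y) (hq : q ≠ 0) :
    ∃ v : Valuation D (WithZero (Multiplicative (ℤ ×ₗ ℤ))),
      v x = exp (toLex (0, 1)) ∧ v y = exp (toLex (1, 0)) ∧
      ∀ c : k, c ≠ 0 → v (algebraMap k D c) = 1 := by
  classical
  let val : D → WithZero (Multiplicative (ℤ ×ₗ ℤ)) := fun d =>
    if h : ∃ γ, FracDeg k x y d γ then exp h.choose else 0
  have hval : ∀ {d γ}, FracDeg k x y d γ → val d = exp γ := by
    intro d γ h
    have h' : ∃ γ, FracDeg k x y d γ := ⟨γ, h⟩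
    simp only [val, dif_pos h']
    rw [h'.choose_spec.unique hD hq h]
  have hval0 : val 0 = 0 := by
    simp only [val]
    rw [dif_neg]
    rintro ⟨γ, h⟩
    exact h.ne_zero hD rfl
  have lead_mon : ∀ (c : k) (p : ℕ × ℕ), c ≠ 0 → Lead k x y (c • mon x y p) (deg p) :=
    fun c p hc => ⟨p, c, 0, hc, rfl, zero_mem _, (add_zero _).symm⟩
  have hdeg : deg 0 = 0 := rfl
  have lead_one : Lead k x y 1 0 := by
    have := lead_mon 1 0 one_ne_zero
    rwa [hdeg, mon, Prod.fst_zero, Prod.snd_zero, pow_zero, pow_zero, one_mul, one_smul] at this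
  have hmon : ∀ (c : k) (p : ℕ × ℕ), c ≠ 0 → val (c • mon x y p) = exp (deg p) :=
    fun c p hc => hval ⟨_, 1, _, 0, lead_mon c p hc, lead_one, one_mul _, (sub_zero _).symm⟩
  have hconst : ∀ c : k, c ≠ 0 → val (algebraMap k D c) = 1 := by
    intro c hc
    have := hmon c 0 hc
    rwa [hdeg, mon, Prod.fst_zero, Prod.snd_zero, pow_zero, pow_zero, one_mul, exp_zero,
      ← Algebra.algebraMap_eq_smul_one] at this
  refine ⟨{ toFun := val, map_zero' := hval0, map_one' := ?_, map_mul' := ?_,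
            map_add_le_max' := ?_ }, ?_, ?_, hconst⟩
  · simpa using hconst 1 one_ne_zero
  · intro d d'
    by_cases hd : d = 0
    · simp [hd, hval0]
    by_cases hd' : d' = 0
    · simp [hd', hval0]
    obtain ⟨γ, h⟩ := exists_fracDeg hD hd
    obtain ⟨γ', h'⟩ := exists_fracDeg hD hd'
    rw [hval h, hval h', hval (h.mul hD hq h'), exp_add]
  · intro d d'
    change val (d + d') ≤ max (val d) (val d')
    by_cases hd : d = 0
    · simp [hd, hval0]
    by_cases hd' : d' = 0
    · simp [hd', hval0]
    by_cases h0 : d + d' = 0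
    · simp [h0, hval0]
    obtain ⟨γ, h⟩ := exists_fracDeg hD hd
    obtain ⟨γ', h'⟩ := exists_fracDeg hD hd'
    obtain ⟨γ'', hle, h''⟩ := h.add_le hD hq h' h0
    rw [hval h, hval h', hval h'']
    rcases le_max_iff.1 hle with hle | hle
    · exact le_max_of_le_left (exp_le_exp.2 hle)
    · exact le_max_of_le_right (exp_le_exp.2 hle)
  · have := hmon 1 (0, 1) one_ne_zero
    simpa [mon, deg] using this
  · have := hmon 1 (1, 0) one_ne_zero
    simpa [mon, deg] using this

theorem linearIndependent_mon_of_valuation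
    (v : Valuation D (WithZero (Multiplicative (ℤ ×ₗ ℤ))))
    (hv : ∀ c : k, c ≠ 0 → v (algebraMap k D c) = 1) {f g : D} {α β : ℤ ×ₗ ℤ}
    (hf : v f = exp α) (hg : v g = exp β)
    (hinj : Function.Injective fun p : ℕ × ℕ => p.1 • β + p.2 • α) :
    LinearIndependent k (mon f g) := by
  classical
  have hterm : ∀ (c : k) (p : ℕ × ℕ), c ≠ 0 →
      v (c • mon f g p) = exp (p.1 • β + p.2 • α) := by
    intro c p hc
    rw [Algebra.smul_def, mon, map_mul, map_mul, map_pow, map_pow, hv c hc, hf, hg, one_mul,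
      exp_add, exp_nsmul, exp_nsmul]
  rw [linearIndependent_iff]
  intro l hl
  by_contra h0
  obtain ⟨p, hp, hmax⟩ := Finset.exists_max_image l.support
    (fun p : ℕ × ℕ => p.1 • β + p.2 • α) (Finsupp.support_nonempty_iff.2 h0)
  rw [Finsupp.linearCombination_apply, Finsupp.sum, ← Finset.add_sum_erase _ _ hp] at hl
  have hlp := Finsupp.mem_support_iff.1 hp
  have h1 : v (∑ p' ∈ l.support.erase p, l p' • mon f g p') < v (l p • mon f g p) := by
    refine v.map_sum_lt ?_ fun p' hp' => ?_
    · rw [hterm _ _ hlp]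
      exact exp_ne_zero
    · rw [Finset.mem_erase] at hp'
      rw [hterm _ _ hlp, hterm _ _ (Finsupp.mem_support_iff.1 hp'.2), exp_lt_exp]
      exact lt_of_le_of_ne (hmax p' hp'.2) fun h => hp'.1 (hinj h)
  have h2 := v.map_add_eq_of_lt_left h1
  rw [hl, map_zero, hterm _ _ hlp] at h2
  exact exp_ne_zero h2.symm

end Lead

section Extension

variable {k D D' : Type*} [Field k] [DivisionRing D] [Algebra k D] [DivisionRing D']
  [Algebra k D'] {q : k} {x y : D} {f g : D'}

theorem fst_eq_zero_iff_snd_eq_zero (hD : IsQDivisionRing k D q x y) (h : f * g = q • (g * f))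
    (hli : LinearIndependent k (mon f g)) {w : D × D'}
    (hw : w ∈ Algebra.adjoin k {((x, f) : D × D'), (y, g)}) : w.1 = 0 ↔ w.2 = 0 := by
  have hrel : ((x, f) : D × D') * (y, g) = q • ((y, g) * (x, f)) :=
    Prod.ext hD.rel_smul h
  obtain ⟨c, rfl⟩ := (mem_adjoin_iff hrel).1 hw
  have h1 : (c.sum fun p t => t • mon ((x, f) : D × D') (y, g) p).1
      = Finsupp.linearCombination k (mon x y) c := by
    rw [Finsupp.linearCombination_apply, Finsupp.sum, Finsupp.sum, Prod.fst_sum]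
    rfl
  have h2 : (c.sum fun p t => t • mon ((x, f) : D × D') (y, g) p).2
      = Finsupp.linearCombination k (mon f g) c := by
    rw [Finsupp.linearCombination_apply, Finsupp.sum, Finsupp.sum, Prod.snd_sum]
    rfl
  rw [h1, h2]
  constructor
  · intro h0
    rw [linearIndependent_iff.1 hD.monomials_linearIndependent c h0, map_zero]
  · intro h0
    rw [linearIndependent_iff.1 hli c h0, map_zero]

theorem exists_algHom (hD : IsQDivisionRing k D q x y) (h : f * g = q • (g * f))
    (hli : LinearIndependent k (mon f g)) : ∃ F : D →ₐ[k] D', F x = f ∧ F y = g := by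
  set B := Algebra.adjoin k {((x, f) : D × D'), (y, g)} with hB
  have hz : ∀ w ∈ B, w.1 = 0 ↔ w.2 = 0 := fun w hw =>
    fst_eq_zero_iff_snd_eq_zero hD h hli hw
  have hlift : ∀ a ∈ Algebra.adjoin k {x, y}, ∃ w ∈ B, w.1 = a := by
    intro a ha
    have hmap : Algebra.adjoin k {x, y} = B.map (AlgHom.fst k D D') := by
      rw [hB, AlgHom.map_adjoin, Set.image_pair]
      rfl
    rw [hmap] at ha
    obtain ⟨w, hw, rfl⟩ := ha
    exact ⟨w, hw, rfl⟩
  have hore : ∀ s ∈ B, ∀ t ∈ B, t.1 ≠ 0 → ∃ u ∈ B, ∃ v ∈ B, u.1 ≠ 0 ∧ u * s = v * t := by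
    intro s hs t ht ht0
    obtain ⟨a, b, ha, hb, ha0, e⟩ := exists_common_left_multiple hD s.1 ht0
    obtain ⟨u, hu, rfl⟩ := hlift a ha
    obtain ⟨v, hv, rfl⟩ := hlift b hb
    refine ⟨u, hu, v, hv, ha0, ?_⟩
    have h1 : (u * s - v * t).1 = 0 := sub_eq_zero.2 e
    have h2 := (hz _ (sub_mem (mul_mem hu hs) (mul_mem hv ht))).1 h1
    exact Prod.ext e (sub_eq_zero.1 h2)
  let Gr : Subalgebra k (D × D') :=
    { carrier := {w | ∃ s ∈ B, ∃ t ∈ B, t.1 ≠ 0 ∧ t * w = s}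
      mul_mem' := by
        rintro w w' ⟨s, hs, t, ht, ht0, e⟩ ⟨s', hs', t', ht', ht0', e'⟩
        obtain ⟨u, hu, v, hv, hu0, huv⟩ := hore s hs t' ht' ht0'
        refine ⟨v * s', mul_mem hv hs', u * t, mul_mem hu ht, mul_ne_zero hu0 ht0, ?_⟩
        rw [mul_assoc u, ← mul_assoc t, e, ← mul_assoc, huv, mul_assoc, e']
      add_mem' := by
        rintro w w' ⟨s, hs, t, ht, ht0, e⟩ ⟨s', hs', t', ht', ht0', e'⟩
        obtain ⟨u, hu, v, hv, hu0, huv⟩ := hore t ht t' ht' ht0'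
        refine ⟨u * s + v * s', add_mem (mul_mem hu hs) (mul_mem hv hs'), u * t, mul_mem hu ht,
          mul_ne_zero hu0 ht0, ?_⟩
        rw [mul_add, mul_assoc, e, huv, mul_assoc, e']
      algebraMap_mem' := fun c =>
        ⟨algebraMap k _ c, B.algebraMap_mem c, 1, one_mem _, one_ne_zero, one_mul _⟩ }
  have hBGr : ∀ w ∈ B, w ∈ Gr := fun w hw => ⟨w, hw, 1, one_mem _, one_ne_zero, one_mul _⟩
  let π : Gr →ₐ[k] D := (AlgHom.fst k D D').comp Gr.val
  have hπ : Function.Bijective π := by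
    constructor
    · rw [injective_iff_map_eq_zero]
      rintro ⟨w, s, hs, t, ht, ht0, e⟩ hw
      replace hw : w.1 = 0 := hw
      have hs1 : s.1 = 0 := by rw [← e, Prod.fst_mul, hw, mul_zero]
      have hs2 := (hz s hs).1 hs1
      rw [← e, Prod.snd_mul] at hs2
      have hw2 : w.2 = 0 := (mul_eq_zero.1 hs2).resolve_left fun h0 => ht0 ((hz t ht).2 h0)
      exact Subtype.ext (Prod.ext hw hw2)
    · intro d
      obtain ⟨s₁, t₁, hs₁, ht₁, ht0, rfl⟩ := hD.exists_frac d
      obtain ⟨s, hs, rfl⟩ := hlift s₁ hs₁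
      obtain ⟨t, ht, rfl⟩ := hlift t₁ ht₁
      refine ⟨⟨(t.1⁻¹ * s.1, t.2⁻¹ * s.2), s, hs, t, ht, ht0, ?_⟩, rfl⟩
      exact Prod.ext (mul_inv_cancel_left₀ ht0 _)
        (mul_inv_cancel_left₀ (fun h0 => ht0 ((hz t ht).2 h0)) _)
  let e := AlgEquiv.ofBijective π hπ
  have hval : ∀ w (hw : w ∈ Gr), (e.symm w.1 : D × D').2 = w.2 := by
    intro w hw
    have : e.symm w.1 = ⟨w, hw⟩ := e.symm_apply_eq.2 rfl
    rw [this]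
  refine ⟨((AlgHom.snd k D D').comp Gr.val).comp (e.symm : D →ₐ[k] Gr), ?_, ?_⟩
  · exact hval (x, f) (hBGr _ (Algebra.subset_adjoin (by simp)))
  · exact hval (y, g) (hBGr _ (Algebra.subset_adjoin (by simp)))

end Extension

section Galois

variable {k D : Type*} [Field k] [DivisionRing D] [Algebra k D] {q : k} {x y : D}

theorem algHom_ext {D' : Type*} [DivisionRing D'] [Algebra k D']
    (hD : IsQDivisionRing k D q x y) {F G : D →ₐ[k] D'} (hx : F x = G x)
    (hy : F y = G y) : F = G :=
  AlgHom.ext <| subfield_eq_top hD ((F : D →+* D').eqLocusField (G : D →+* D'))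
    (fun c => (F.commutes c).trans (G.commutes c).symm) hx hy

theorem forall_conj_mem (hD : IsQDivisionRing k D q x y) {L : Subfield D}
    (hL : ∀ c : k, algebraMap k D c ∈ L) (F : D →ₐ[k] D) {ρ : D} (hρ : ρ ≠ 0)
    (hx : ρ * F x * ρ⁻¹ ∈ L) (hy : ρ * F y * ρ⁻¹ ∈ L) (d : D) : ρ * F d * ρ⁻¹ ∈ L := by
  have hρ' : ρ⁻¹ * ρ = 1 := inv_mul_cancel₀ hρ
  refine subfield_eq_top hD
    { carrier := {d | ρ * F d * ρ⁻¹ ∈ L}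
      mul_mem' := ?_
      one_mem' := ?_
      add_mem' := ?_
      zero_mem' := ?_
      neg_mem' := ?_
      inv_mem' := ?_ } ?_ hx hy d
  · intro a b ha hb
    have : ρ * F (a * b) * ρ⁻¹ = ρ * F a * ρ⁻¹ * (ρ * F b * ρ⁻¹) := by
      simp only [map_mul, mul_assoc]
      rw [← mul_assoc ρ⁻¹ ρ, hρ', one_mul]
    rw [Set.mem_ofPred_eq, this]
    exact mul_mem ha hb
  · simp [hρ, one_mem]
  · intro a b ha hb
    rw [Set.mem_ofPred_eq, map_add, mul_add, add_mul]
    exact add_mem ha hb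
  · simp [zero_mem]
  · intro a ha
    rw [Set.mem_ofPred_eq, map_neg, mul_neg, neg_mul]
    exact neg_mem ha
  · intro a ha
    have : ρ * F a⁻¹ * ρ⁻¹ = (ρ * F a * ρ⁻¹)⁻¹ := by
      simp [mul_assoc]
    rw [Set.mem_ofPred_eq, this]
    exact inv_mem ha
  · intro c
    change ρ * F (algebraMap k D c) * ρ⁻¹ ∈ L
    rw [F.commutes, ← Algebra.commutes, mul_assoc, mul_inv_cancel₀ hρ, mul_one]
    exact hL c

/-- The `L`-span of the powers of an element normalising `L` is a division ring as soon as it is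
finite dimensional. -/
theorem exists_subfield_span_pow {L : Subfield D} {ρ : D} {n : ℕ} (hn : 0 < n)
    (hρn : ρ ^ n ∈ L) (hρ : ρ ≠ 0) (hconj : ∀ l ∈ L, ρ * l * ρ⁻¹ ∈ L) :
    ∃ S : Subfield D, ∀ d, d ∈ S ↔
      d ∈ Submodule.span L (Set.range fun i : Fin n => ρ ^ (i : ℕ)) := by
  set M := Submodule.span L (Set.range fun i : Fin n => ρ ^ (i : ℕ)) with hM
  have hpow : ∀ i : ℕ, ρ ^ i ∈ M := by
    intro i
    have h1 : ρ ^ i = (⟨(ρ ^ n) ^ (i / n), pow_mem hρn _⟩ : L) • ρ ^ (i % n) := by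
      rw [Subfield.smul_def, smul_eq_mul]
      dsimp only
      rw [← pow_mul, ← pow_add, Nat.div_add_mod]
    rw [h1]
    exact Submodule.smul_mem _ _ (Submodule.subset_span ⟨⟨i % n, Nat.mod_lt i hn⟩, rfl⟩)
  have hconj' : ∀ (i : ℕ) (l : L), ∃ l' : L, ρ ^ i * l = l' * ρ ^ i := by
    intro i
    induction i with
    | zero => exact fun l => ⟨l, by simp⟩
    | succ i ih =>
      intro l
      obtain ⟨l', hl'⟩ := ih l
      refine ⟨⟨_, hconj l' l'.2⟩, ?_⟩
      rw [pow_succ', mul_assoc, hl', ← mul_assoc, ← mul_assoc, inv_mul_cancel_right₀ hρ]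
  have hmul1 : ∀ m ∈ M, ∀ i : ℕ, ρ ^ i * m ∈ M := by
    intro m hm
    induction hm using Submodule.span_induction with
    | mem m hm =>
      obtain ⟨j, rfl⟩ := hm
      intro i
      dsimp only
      rw [← pow_add]
      exact hpow _
    | zero => simp
    | add a b _ _ ha hb => exact fun i => by rw [mul_add]; exact add_mem (ha i) (hb i)
    | smul l a _ ha =>
      intro i
      obtain ⟨l', hl'⟩ := hconj' i l
      rw [Subfield.smul_def, smul_eq_mul, ← mul_assoc, hl', mul_assoc]
      exact Submodule.smul_mem _ l' (ha i)
  have hmul : ∀ m ∈ M, ∀ m' ∈ M, m * m' ∈ M := by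
    intro m hm m' hm'
    induction hm using Submodule.span_induction with
    | mem m hm =>
      obtain ⟨j, rfl⟩ := hm
      exact hmul1 m' hm' j
    | zero => simp
    | add a b _ _ ha hb => rw [add_mul]; exact add_mem ha hb
    | smul l a _ ha =>
      rw [Subfield.smul_def, smul_eq_mul, mul_assoc]
      exact Submodule.smul_mem _ l ha
  have h1 : (1 : D) ∈ M := by simpa using hpow 0
  have hfin : FiniteDimensional L M := FiniteDimensional.span_of_finite L (Set.finite_range _)
  refine ⟨{ carrier := M, mul_mem' := fun ha hb => hmul _ ha _ hb, one_mem' := h1,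
            add_mem' := add_mem, zero_mem' := zero_mem _, neg_mem' := neg_mem,
            inv_mem' := ?_ }, fun d => Iff.rfl⟩
  intro m hm
  by_cases hm0 : m = 0
  · rw [hm0, inv_zero]
    exact zero_mem M
  let R : M →ₗ[L] M :=
    { toFun := fun a => ⟨a * m, hmul _ a.2 _ hm⟩
      map_add' := fun a b => Subtype.ext (add_mul _ _ _)
      map_smul' := fun l a => Subtype.ext (mul_assoc _ _ _) }
  have hinj : Function.Injective R := by
    intro a b hab
    exact Subtype.ext (mul_right_cancel₀ hm0 (congrArg Subtype.val hab))
  obtain ⟨a, ha⟩ := (LinearMap.injective_iff_surjective.1 hinj) ⟨1, h1⟩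
  have ha' : (a : D) * m = 1 := congrArg Subtype.val ha
  rw [← eq_inv_of_mul_eq_one_left ha']
  exact a.2

theorem range_eq_fixed (hD : IsQDivisionRing k D q x y) (F σ : D →ₐ[k] D) {n : ℕ}
    (hn : (n : k) ≠ 0) {ζ : k} (hζ : IsPrimitiveRoot ζ n) {ρ : D} (hρ : ρ ≠ 0)
    (hσρ : σ ρ = ζ • ρ) (hσx : σ (F x) = F x) (hσy : σ (F y) = F y)
    (hρn : ρ ^ n ∈ (F : D →+* D).fieldRange)
    (hρx : ρ * F x * ρ⁻¹ ∈ (F : D →+* D).fieldRange)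
    (hρy : ρ * F y * ρ⁻¹ ∈ (F : D →+* D).fieldRange)
    (hgen : ∀ S : Subfield D, (F : D →+* D).fieldRange ≤ S → ρ ∈ S → x ∈ S ∧ y ∈ S) :
    Set.range F = {d | σ d = d} := by
  set L := (F : D →+* D).fieldRange with hL
  have hFL : ∀ d, F d ∈ L := fun d => ⟨d, rfl⟩
  have hkL : ∀ c : k, algebraMap k D c ∈ L := fun c => by
    rw [← F.commutes c]
    exact hFL _
  have hfix : ∀ l ∈ L, σ l = l := by
    rintro _ ⟨d, rfl⟩
    exact DFunLike.congr_fun (algHom_ext hD (F := σ.comp F) (G := F) hσx hσy) d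
  have hn0 : 0 < n := Nat.pos_of_ne_zero fun h => hn (by rw [h, Nat.cast_zero])
  have hconj : ∀ l ∈ L, ρ * l * ρ⁻¹ ∈ L := by
    rintro _ ⟨d, rfl⟩
    exact forall_conj_mem hD hkL F hρ hρx hρy d
  obtain ⟨S, hS⟩ := exists_subfield_span_pow hn0 hρn hρ hconj
  have hpowS : ∀ i : Fin n, ρ ^ (i : ℕ) ∈ S := fun i =>
    (hS _).2 (Submodule.subset_span ⟨i, rfl⟩)
  have hLS : L ≤ S := by
    intro l hl
    rw [hS]
    have := Submodule.smul_mem _ (⟨l, hl⟩ : L) ((hS _).1 (one_mem S))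
    rwa [Subfield.smul_def, smul_eq_mul, mul_one] at this
  have hρS : ρ ∈ S := by
    by_cases h1 : n = 1
    · subst h1
      rw [pow_one] at hρn
      exact hLS hρn
    · simpa using hpowS ⟨1, by omega⟩
  obtain ⟨hxS, hyS⟩ := hgen S hLS hρS
  have htop : ∀ d, d ∈ S := subfield_eq_top hD S (fun c => hLS (hkL c)) hxS hyS
  have hσpow : ∀ j i : ℕ, (σ ^ j) (ρ ^ i) = (ζ ^ i) ^ j • ρ ^ i := by
    intro j i
    induction j with
    | zero => simp
    | succ j ih =>
      rw [pow_succ', AlgHom.mul_apply, ih, map_smul, map_pow, hσρ, smul_pow, smul_smul,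
        pow_succ]
  have hσL : ∀ (j : ℕ) (l : L), (σ ^ j) l = l := by
    intro j l
    induction j with
    | zero => simp
    | succ j ih => rw [pow_succ', AlgHom.mul_apply, ih, hfix l l.2]
  have htr : ∀ d, ∑ j ∈ Finset.range n, (σ ^ j) d ∈ L := by
    intro d
    have hd := (hS d).1 (htop d)
    induction hd using Submodule.span_induction with
    | mem m hm =>
      obtain ⟨i, rfl⟩ := hm
      simp only [hσpow]
      rw [← Finset.sum_smul]
      by_cases hi : (i : ℕ) = 0
      · rw [hi, pow_zero ρ, Algebra.smul_def, mul_one]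
        exact hkL _
      · have h1 : ζ ^ (i : ℕ) ≠ 1 := hζ.pow_ne_one_of_pos_of_lt hi i.2
        have h2 := mul_geom_sum (ζ ^ (i : ℕ)) n
        rw [← pow_mul, mul_comm (i : ℕ), pow_mul, hζ.pow_eq_one, one_pow, sub_self,
          mul_eq_zero] at h2
        rw [h2.resolve_left (sub_ne_zero.2 h1), zero_smul]
        exact zero_mem _
    | zero => simp [zero_mem]
    | add a b _ _ ha hb =>
      simp only [map_add, Finset.sum_add_distrib]
      exact add_mem ha hb
    | smul l a _ ha =>
      simp only [Subfield.smul_def, smul_eq_mul, map_mul, hσL, ← Finset.mul_sum]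
      exact mul_mem l.2 ha
  apply Set.Subset.antisymm
  · rintro _ ⟨d, rfl⟩
    exact hfix _ (hFL d)
  · intro d hd
    have h1 : ∀ j : ℕ, (σ ^ j) d = d := by
      intro j
      induction j with
      | zero => simp
      | succ j ih =>
        rw [pow_succ', AlgHom.mul_apply, ih]
        exact hd
    have h2 := htr d
    simp only [h1, Finset.sum_const, Finset.card_range] at h2
    have h3 : d = algebraMap k D (n : k)⁻¹ * n • d := by
      rw [← Nat.cast_smul_eq_nsmul k, Algebra.smul_def, ← mul_assoc, ← map_mul,
        inv_mul_cancel₀ hn, map_one, one_mul]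
    rw [h3]
    exact mul_mem (hkL _) h2

end Galois

section Inversion

variable {k D : Type*} [Field k] [DivisionRing D] [Algebra k D]

theorem mul_mul_of_rel {a b d : D} {c : k} (h : a * b = c • d) (r : D) :
    a * (b * r) = c • (d * r) := by
  rw [← mul_assoc, h, smul_mul_assoc]

theorem mul_mul_of_mul {a b d : D} (h : a * b = d) (r : D) : a * (b * r) = d * r := by
  rw [← mul_assoc, h]

variable {x y : D} {q : k}

theorem mul_inv_rel (h : x * y = q • (y * x)) (hq : q ≠ 0) (hy : y ≠ 0) :
    x * y⁻¹ = q⁻¹ • (y⁻¹ * x) := by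
  rw [eq_inv_smul_iff₀ hq, ← mul_left_inj' hy, smul_mul_assoc, inv_mul_cancel_right₀ hy,
    mul_assoc, h, mul_smul_comm, inv_mul_cancel_left₀ hy]

theorem inv_mul_rel (h : x * y = q • (y * x)) (hq : q ≠ 0) (hx : x ≠ 0) :
    x⁻¹ * y = q⁻¹ • (y * x⁻¹) := by
  rw [eq_inv_smul_iff₀ hq, ← mul_right_inj' hx, mul_smul_comm, mul_inv_cancel_left₀ hx,
    ← mul_assoc, h, smul_mul_assoc, mul_inv_cancel_right₀ hx]

theorem inv_mul_inv_rel (h : x * y = q • (y * x)) (hq : q ≠ 0) (hx : x ≠ 0) (hy : y ≠ 0) :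
    x⁻¹ * y⁻¹ = q • (y⁻¹ * x⁻¹) := by
  simpa using inv_mul_rel (mul_inv_rel h hq hy) (inv_ne_zero hq) hx

set_option linter.unusedSimpArgs false in
theorem inversion_identities {s : k} (hs : s ≠ 0) (h : x * y = s ^ 2 • (y * x)) (hx : x ≠ 0)
    (hy : y ≠ 0) {X₁ X₂ X₃ T₁ T₂ T₃ : D} (hX₁ : X₁ = x - x⁻¹) (hX₂ : X₂ = y - y⁻¹)
    (hX₃ : X₃ = s • (y * x) - s • (y⁻¹ * x⁻¹)) (hT₁ : T₁ = x + x⁻¹) (hT₂ : T₂ = y + y⁻¹)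
    (hT₃ : T₃ = s • (y * x) + s • (y⁻¹ * x⁻¹)) (hX₂0 : X₂ ≠ 0) :
    T₁ * X₂ + X₁ * T₂ = (2 * s) • X₃ ∧ X₃ * T₂ - T₃ * X₂ = (2 * s⁻¹) • X₁ ∧
    X₂ * T₁ = s ^ 2 • (T₁ * X₂) + (s⁻¹ - s ^ 3) • X₃ ∧
    T₂ * X₁ = s ^ 2 • (X₁ * T₂) + (s⁻¹ - s ^ 3) • X₃ ∧
    X₁ * T₁ = T₁ * X₁ ∧ X₂ * T₂ = T₂ * X₂ ∧
    X₁ * X₁ = T₁ * T₁ - (4 : k) • 1 ∧ X₂ * X₂ = T₂ * T₂ - (4 : k) • 1 ∧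
    X₃ * X₃ = T₃ * T₃ - (4 : k) • 1 ∧
    X₃ * X₂⁻¹ * T₁ * X₂ = s⁻¹ • X₂ + s • (X₃ * X₂⁻¹ * X₃) - (s⁻¹ ^ 3) • (X₁ * X₂⁻¹ * X₁) := by
  have hq : s ^ 2 ≠ 0 := pow_ne_zero _ hs
  have r2 := mul_inv_rel h hq hy
  have r3 := inv_mul_rel h hq hx
  have r4 := inv_mul_inv_rel h hq hx hy
  have a1 := mul_mul_of_rel h
  have a2 := mul_mul_of_rel r2
  have a3 := mul_mul_of_rel r3
  have a4 := mul_mul_of_rel r4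
  have x1 := mul_inv_cancel_left₀ hx
  have x2 := inv_mul_cancel_left₀ hx
  have y1 := mul_inv_cancel_left₀ hy
  have y2 := inv_mul_cancel_left₀ hy
  have x3 := mul_inv_cancel₀ hx
  have x4 := inv_mul_cancel₀ hx
  have y3 := mul_inv_cancel₀ hy
  have y4 := inv_mul_cancel₀ hy
  refine ⟨?_, ?_, ?_, ?_, ?_, ?_, ?_, ?_, ?_, ?_⟩
  iterate 9
    subst hX₁ hX₂ hX₃ hT₁ hT₂ hT₃
    simp only [mul_add, add_mul, mul_sub, sub_mul, mul_assoc, smul_mul_assoc, mul_smul_comm,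
      smul_add, smul_sub, smul_smul, h, r2, r3, r4, a1, a2, a3, a4, x1, x2, y1, y2, x3, x4, y3, y4]
    match_scalars <;> first | ring1 | (field_simp <;> ring1)
  obtain ⟨w, hw⟩ : ∃ w, X₂⁻¹ = w := ⟨_, rfl⟩
  have hwX : w * X₂ = 1 := by rw [← hw, inv_mul_cancel₀ hX₂0]
  have hXw : X₂ * w = 1 := by rw [← hw, mul_inv_cancel₀ hX₂0]
  have hc : Commute X₂ y := by
    rw [hX₂]
    exact (Commute.refl y).sub_left (Commute.refl y).inv_left₀
  have w1 : w * y = y * w := hw ▸ hc.inv_left₀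
  have w2 : w * y⁻¹ = y⁻¹ * w := hw ▸ hc.inv_left₀.inv_right₀
  have w3 := mul_mul_of_mul w1
  have w4 := mul_mul_of_mul w2
  have e : x * X₂ * w = x := by rw [mul_assoc, hXw, mul_one]
  have e' : x⁻¹ * X₂ * w = x⁻¹ := by rw [mul_assoc, hXw, mul_one]
  rw [hw]
  clear hw hwX hXw hc
  subst hX₁ hX₂ hX₃ hT₁ hT₂ hT₃
  simp only [mul_sub, sub_mul, h, r2, r3, r4, smul_mul_assoc, mul_assoc] at e e'
  have f1 : y⁻¹ * (x * w) = (s ^ 4) • (y * (x * w)) - (s ^ 2) • x := by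
    linear_combination (norm := skip) (-s ^ 2) • e
    match_scalars <;> first | ring1 | (field_simp; ring1)
  have f2 : y⁻¹ * (x⁻¹ * w) = (s⁻¹ ^ 4) • (y * (x⁻¹ * w)) - (s⁻¹ ^ 2) • x⁻¹ := by
    linear_combination (norm := skip) (-(s⁻¹ ^ 2)) • e'
    match_scalars <;> first | ring1 | (field_simp; ring1)
  have f3 (r : D) : y⁻¹ * (x * (w * r)) = (s ^ 4) • (y * (x * (w * r))) - (s ^ 2) • (x * r) := by
    simpa only [mul_assoc, sub_mul, smul_mul_assoc] using congrArg (· * r) f1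
  have f4 (r : D) : y⁻¹ * (x⁻¹ * (w * r)) =
      (s⁻¹ ^ 4) • (y * (x⁻¹ * (w * r))) - (s⁻¹ ^ 2) • (x⁻¹ * r) := by
    simpa only [mul_assoc, sub_mul, smul_mul_assoc] using congrArg (· * r) f2
  have g3 (r : D) : y * (y * (x * (w * r))) =
      (s⁻¹ ^ 4) • (x * (w * r)) + (s⁻¹ ^ 2) • (y * (x * r)) := by
    have := congrArg (y * ·) (f3 r)
    simp only [mul_sub, mul_smul_comm, y1] at this
    linear_combination (norm := skip) (-(s⁻¹ ^ 4)) • this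
    match_scalars <;> first | ring1 | (field_simp; ring1)
  have g4 (r : D) : y * (y * (x⁻¹ * (w * r))) =
      (s ^ 4) • (x⁻¹ * (w * r)) + (s ^ 2) • (y * (x⁻¹ * r)) := by
    have := congrArg (y * ·) (f4 r)
    simp only [mul_sub, mul_smul_comm, y1] at this
    linear_combination (norm := skip) (-(s ^ 4)) • this
    match_scalars <;> first | ring1 | (field_simp; ring1)
  simp only [mul_add, add_mul, mul_sub, sub_mul, mul_assoc, smul_mul_assoc, mul_smul_comm,
    smul_add, smul_sub, smul_smul, h, r2, r3, r4, a1, a2, a3, a4, x1, x2, y1, y2, x3, x4, y3, y4,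
    w1, w2, w3, w4, f3, f4, g3, g4, mul_one, one_mul]
  match_scalars <;> first | ring1 | (field_simp <;> ring1)

end Inversion

section InversionFixed

open WithZero

variable {k D : Type*} [Field k] [DivisionRing D] [Algebra k D] {x y : D} {s : k}

theorem valuation_sub_inv (v : Valuation D (WithZero (Multiplicative (ℤ ×ₗ ℤ)))) {f : D}
    {γ : ℤ ×ₗ ℤ} (hf : v f = exp γ) (hγ : -γ < γ) : v (f - f⁻¹) = exp γ := by
  rw [← hf]
  refine v.map_sub_eq_of_lt_left ?_
  rw [map_inv₀, hf, ← exp_neg, exp_lt_exp]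
  exact hγ

theorem valuation_smul {v : Valuation D (WithZero (Multiplicative (ℤ ×ₗ ℤ)))}
    (hv : ∀ c : k, c ≠ 0 → v (algebraMap k D c) = 1) {c : k} (hc : c ≠ 0) (d : D) :
    v (c • d) = v d := by
  rw [Algebra.smul_def, map_mul, hv c hc, one_mul]

theorem ne_zero_of_valuation {v : Valuation D (WithZero (Multiplicative (ℤ ×ₗ ℤ)))} {d : D}
    {γ : ℤ ×ₗ ℤ} (h : v d = exp γ) : d ≠ 0 := by
  rintro rfl
  rw [map_zero] at h
  exact exp_ne_zero h.symm

theorem smul_mem_of_algebraMap_mem {L : Subfield D} (hL : ∀ c : k, algebraMap k D c ∈ L) (c : k)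
    {d : D} (hd : d ∈ L) : c • d ∈ L := by
  rw [Algebra.smul_def]
  exact mul_mem (hL c) hd

theorem mem_of_mul_mem {L : Subfield D} {a b : D} (ha : a ∈ L) (ha0 : a ≠ 0)
    (hab : a * b ∈ L) : b ∈ L := by
  rw [← inv_mul_cancel_left₀ ha0 b]
  exact mul_mem (inv_mem ha) hab

/-- The fixed ring of the inversion automorphism `x ↦ x⁻¹`, `y ↦ y⁻¹` is a `q`-division ring. -/
theorem exists_range_eq_fixed_inversion [CharZero k] (hD : IsQDivisionRing k D (s ^ 2) x y)
    (hs : s ≠ 0) (τ : D →ₐ[k] D) (hτx : τ x = x⁻¹) (hτy : τ y = y⁻¹) :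
    ∃ F : D →ₐ[k] D, F x = (x - x⁻¹) * (y - y⁻¹)⁻¹ ∧
      F y = (s • (y * x) - s • (y⁻¹ * x⁻¹)) * (y - y⁻¹)⁻¹ ∧ Set.range F = {d | τ d = d} := by
  have hq : s ^ 2 ≠ 0 := pow_ne_zero _ hs
  have hx := hD.x_ne_zero
  have hy := hD.y_ne_zero
  obtain ⟨v, hvx, hvy, hvk⟩ := exists_valuation hD hq
  obtain ⟨X₁, hX₁⟩ : ∃ X₁, X₁ = x - x⁻¹ := ⟨_, rfl⟩
  obtain ⟨X₂, hX₂⟩ : ∃ X₂, X₂ = y - y⁻¹ := ⟨_, rfl⟩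
  obtain ⟨X₃, hX₃⟩ : ∃ X₃, X₃ = s • (y * x) - s • (y⁻¹ * x⁻¹) := ⟨_, rfl⟩
  obtain ⟨T₁, hT₁⟩ : ∃ T₁, T₁ = x + x⁻¹ := ⟨_, rfl⟩
  obtain ⟨T₂, hT₂⟩ : ∃ T₂, T₂ = y + y⁻¹ := ⟨_, rfl⟩
  obtain ⟨T₃, hT₃⟩ : ∃ T₃, T₃ = s • (y * x) + s • (y⁻¹ * x⁻¹) := ⟨_, rfl⟩
  have hv₁ : v X₁ = exp (toLex (0, 1)) := hX₁ ▸ valuation_sub_inv v hvx (by decide)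
  have hv₂ : v X₂ = exp (toLex (1, 0)) := hX₂ ▸ valuation_sub_inv v hvy (by decide)
  have hv₃ : v X₃ = exp (toLex (1, 1)) := by
    have h1 : v (s • (y * x)) = exp (toLex (1, 1)) := by
      rw [valuation_smul hvk hs, map_mul, hvx, hvy, ← exp_add]
      rfl
    rw [hX₃, ← h1]
    refine v.map_sub_eq_of_lt_left ?_
    rw [h1, valuation_smul hvk hs, map_mul, map_inv₀, map_inv₀, hvx, hvy, ← exp_neg, ← exp_neg,
      ← exp_add, exp_lt_exp]
    decide
  have hX₁0 := ne_zero_of_valuation hv₁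
  have hX₂0 := ne_zero_of_valuation hv₂
  have hX₃0 := ne_zero_of_valuation hv₃
  have h2 : (2 : k) ≠ 0 := two_ne_zero
  rw [← hX₁, ← hX₂, ← hX₃]
  obtain ⟨i1, i2, i3, i4, i5, i6, i7, i8, i9, i10⟩ :=
    inversion_identities hs hD.rel_smul hx hy hX₁ hX₂ hX₃ hT₁ hT₂ hT₃ hX₂0
  obtain ⟨u, hu⟩ : ∃ u, u = X₁ * X₂⁻¹ := ⟨_, rfl⟩
  obtain ⟨w, hw⟩ : ∃ w, w = X₃ * X₂⁻¹ := ⟨_, rfl⟩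
  have huX : u * X₂ = X₁ := by rw [hu, inv_mul_cancel_right₀ hX₂0]
  have hwX : w * X₂ = X₃ := by rw [hw, inv_mul_cancel_right₀ hX₂0]
  have hvu : v u = exp (toLex (-1, 1)) := by
    rw [hu, map_mul, map_inv₀, hv₁, hv₂, ← exp_neg, ← exp_add]
    rfl
  have hvw : v w = exp (toLex (0, 1)) := by
    rw [hw, map_mul, map_inv₀, hv₃, hv₂, ← exp_neg, ← exp_add]
    rfl
  have hu0 := ne_zero_of_valuation hvu
  have hw0 := ne_zero_of_valuation hvw
  have j1 : T₁ + u * T₂ = (2 * s) • w := by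
    rw [← mul_left_inj' hX₂0, smul_mul_assoc, hwX, ← i1, add_mul, mul_assoc, ← i6, ← mul_assoc,
      huX]
  have j2 : w * T₂ - T₃ = (2 * s⁻¹) • u := by
    rw [← mul_left_inj' hX₂0, smul_mul_assoc, huX, ← i2, sub_mul, mul_assoc, ← i6, ← mul_assoc,
      hwX]
  have j3 : T₁ * u = s ^ 2 • (u * T₁) + (s⁻¹ - s ^ 3) • (u * w) := by
    have h := congrArg (u * ·) i3
    simp only [mul_add, mul_smul_comm, ← mul_assoc, huX] at h
    rw [i5, ← huX, ← hwX] at h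
    rw [← mul_left_inj' hX₂0]
    simpa only [add_mul, smul_mul_assoc, mul_assoc] using h
  have j4 : T₂ * u = s ^ 2 • (u * T₂) + (s⁻¹ - s ^ 3) • w := by
    rw [← mul_left_inj' hX₂0]
    simp only [add_mul, smul_mul_assoc, mul_assoc, huX, hwX, ← i6]
    rw [i4, ← mul_assoc u, huX]
  have hrel : u * w = s ^ 2 • (w * u) := by
    have h2s : (2 * s) ≠ 0 := mul_ne_zero h2 hs
    have e1 := congrArg (· * u) j1
    have e2 := congrArg (u * ·) j1
    simp only [add_mul, mul_add, smul_mul_assoc, mul_smul_comm, mul_assoc, j3, j4] at e1 e2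
    have e3 : (s⁻¹ ^ 2) • (u * w) - w * u = 0 := by
      rw [← smul_right_inj h2s, smul_zero]
      linear_combination (norm := skip) e1 - (s ^ 2) • e2
      match_scalars <;> field_simp <;> ring1
    rw [sub_eq_zero] at e3
    rw [← e3, smul_smul, ← mul_pow, mul_inv_cancel₀ hs, one_pow, one_smul]
  have hli : LinearIndependent k (mon u w) := by
    refine linearIndependent_mon_of_valuation v hvk hvu hvw ?_
    rintro ⟨a, b⟩ ⟨c, d⟩ h
    have := congrArg ofLex h
    simp [Prod.ext_iff] at this
    simp
    omega
  obtain ⟨F, hFx, hFy⟩ := exists_algHom hD hrel hli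
  refine ⟨F, hFx.trans hu, hFy.trans hw, ?_⟩
  have hk : ∀ c : k, algebraMap k D c ∈ (F : D →+* D).fieldRange := fun c =>
    ⟨algebraMap k D c, F.commutes c⟩
  have huL : u ∈ (F : D →+* D).fieldRange := ⟨x, hFx⟩
  have hwL : w ∈ (F : D →+* D).fieldRange := ⟨y, hFy⟩
  have j5 : w * T₁ = s⁻¹ • 1 + s • (w * w) - (s⁻¹ ^ 3) • (u * u) := by
    rw [← mul_left_inj' hX₂0]
    simp only [add_mul, sub_mul, smul_mul_assoc, one_mul, mul_assoc, huX, hwX]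
    rw [← mul_assoc, hw, hu, i10]
  have hT₁L : T₁ ∈ (F : D →+* D).fieldRange := by
    refine mem_of_mul_mem hwL hw0 ?_
    rw [j5]
    exact sub_mem (add_mem (smul_mem_of_algebraMap_mem hk _ (one_mem _))
      (smul_mem_of_algebraMap_mem hk _ (mul_mem hwL hwL)))
      (smul_mem_of_algebraMap_mem hk _ (mul_mem huL huL))
  have hT₂L : T₂ ∈ (F : D →+* D).fieldRange := by
    refine mem_of_mul_mem huL hu0 ?_
    rw [eq_sub_of_add_eq' j1]
    exact sub_mem (smul_mem_of_algebraMap_mem hk _ hwL) hT₁L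
  have hT₃L : T₃ ∈ (F : D →+* D).fieldRange := by
    rw [sub_eq_iff_eq_add, ← sub_eq_iff_eq_add'] at j2
    rw [← j2]
    exact sub_mem (mul_mem hwL hT₂L) (smul_mem_of_algebraMap_mem hk _ huL)
  have h4 := smul_mem_of_algebraMap_mem hk 4 (one_mem _)
  have hX₁L : X₁ * X₁ ∈ (F : D →+* D).fieldRange := i7 ▸ sub_mem (mul_mem hT₁L hT₁L) h4
  have hX₂L : X₂ * X₂ ∈ (F : D →+* D).fieldRange := i8 ▸ sub_mem (mul_mem hT₂L hT₂L) h4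
  have hX₃L : X₃ * X₃ ∈ (F : D →+* D).fieldRange := i9 ▸ sub_mem (mul_mem hT₃L hT₃L) h4
  have hτ₁ : τ X₁ = -X₁ := by rw [hX₁, map_sub, map_inv₀, hτx, inv_inv, neg_sub]
  have hτ₂ : τ X₂ = -X₂ := by rw [hX₂, map_sub, map_inv₀, hτy, inv_inv, neg_sub]
  have hτ₃ : τ X₃ = -X₃ := by
    rw [hX₃, map_sub, map_smul, map_smul, map_mul, map_mul, map_inv₀, map_inv₀, hτx, hτy,
      inv_inv, inv_inv, neg_sub]
  refine range_eq_fixed hD F τ (n := 2) (by exact_mod_cast h2) (ζ := -1)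
    (IsPrimitiveRoot.neg_one 0 (by decide)) hX₂0 (by rw [hτ₂, neg_smul, one_smul]) ?_ ?_ ?_ ?_ ?_ ?_
  · rw [hFx, hu, map_mul, map_inv₀, hτ₁, hτ₂, inv_neg, neg_mul_neg]
  · rw [hFy, hw, map_mul, map_inv₀, hτ₃, hτ₂, inv_neg, neg_mul_neg]
  · rw [pow_two]
    exact hX₂L
  · have h1 : X₂ * F x * X₂⁻¹ = u⁻¹ * (X₁ * X₁) * (X₂ * X₂)⁻¹ := by
      rw [hFx, hu, mul_inv_rev, mul_inv_rev, inv_inv]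
      simp only [mul_assoc]
      rw [inv_mul_cancel_left₀ hX₁0]
    rw [h1]
    exact mul_mem (mul_mem (inv_mem huL) hX₁L) (inv_mem hX₂L)
  · have h1 : X₂ * F y * X₂⁻¹ = w⁻¹ * (X₃ * X₃) * (X₂ * X₂)⁻¹ := by
      rw [hFy, hw, mul_inv_rev, mul_inv_rev, inv_inv]
      simp only [mul_assoc]
      rw [inv_mul_cancel_left₀ hX₃0]
    rw [h1]
    exact mul_mem (mul_mem (inv_mem hwL) hX₃L) (inv_mem hX₂L)
  · intro S hLS hρ
    have hkS : ∀ c : k, algebraMap k D c ∈ S := fun c => hLS (hk c)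
    have e1 : x = (2⁻¹ : k) • (T₁ + u * X₂) := by
      rw [huX, hT₁, hX₁, add_add_sub_cancel, ← two_smul k, smul_smul, inv_mul_cancel₀ h2, one_smul]
    have e2 : y = (2⁻¹ : k) • (T₂ + X₂) := by
      rw [hT₂, hX₂, add_add_sub_cancel, ← two_smul k, smul_smul, inv_mul_cancel₀ h2, one_smul]
    constructor
    · rw [e1]
      exact smul_mem_of_algebraMap_mem hkS _ (add_mem (hLS hT₁L) (mul_mem (hLS huL) hρ))
    · rw [e2]
      exact smul_mem_of_algebraMap_mem hkS _ (add_mem (hLS hT₂L) hρ)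

end InversionFixed

section Cubic

variable {k D : Type*} [Field k] [DivisionRing D] [Algebra k D] {x y : D} {q ω : k}

set_option linter.unusedSimpArgs false in
set_option maxHeartbeats 1000000 in
theorem cubic_identities (hq : q ≠ 0) (hω : ω ^ 2 + ω + 1 = 0)
    (h : x * y = q • (y * x)) (hx : x ≠ 0) (hy : y ≠ 0) {a a' t θ u φ E g : D}
    (ha : a = -y - x * y⁻¹ + x⁻¹) (ha' : a' = -y⁻¹ - y * x⁻¹ + x)
    (ht : t = -y - ω • (x * y⁻¹) + ω ^ 2 • x⁻¹) (hu : u = -y⁻¹ - ω • (y * x⁻¹) + ω ^ 2 • x)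
    (hθ : θ = -y - ω ^ 2 • (x * y⁻¹) + ω • x⁻¹) (hφ : φ = -y⁻¹ - ω ^ 2 • (y * x⁻¹) + ω • x)
    (hE : E = y * x⁻¹ * y - x * (x * y⁻¹) - y⁻¹ * x⁻¹)
    (hg : g = x * y⁻¹ * y⁻¹ - x⁻¹ * (y * x⁻¹) - y * x) :
    θ * a = a * θ + ((ω - ω ^ 2) * (1 - q⁻¹)) • φ ∧
    φ * a' = a' * φ + ((ω ^ 2 - ω) * (1 - q)) • θ ∧
    a * a = θ * t + (1 + q⁻¹ - ω ^ 2 - q⁻¹ * ω) • a' ∧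
    t * θ = a * a + (ω + q⁻¹ * ω ^ 2 - 1 - q⁻¹) • a' ∧
    u * φ = a' * a' + (ω ^ 2 + q * ω - 1 - q) • a ∧
    φ * u = a' * a' + (ω + q * ω ^ 2 - 1 - q) • a ∧
    t * φ + a * a' + θ * u = (9 : k) • 1 ∧
    θ * φ + a * u + t * a' = 0 ∧
    a * a' = (3 : k) • 1 + q • E + g ∧
    a' * a = (3 : k) • 1 + E + q • g ∧
    φ * t = (3 : k) • 1 + ω ^ 2 • E + (q * ω) • g ∧
    θ * u = (3 : k) • 1 + (q * ω) • E + ω ^ 2 • g := by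
  have r2 := mul_inv_rel h hq hy
  have r3 := inv_mul_rel h hq hx
  have r4 := inv_mul_inv_rel h hq hx hy
  have a1 := mul_mul_of_rel h
  have a2 := mul_mul_of_rel r2
  have a3 := mul_mul_of_rel r3
  have a4 := mul_mul_of_rel r4
  have x1 := mul_inv_cancel_left₀ hx
  have x2 := inv_mul_cancel_left₀ hx
  have y1 := mul_inv_cancel_left₀ hy
  have y2 := inv_mul_cancel_left₀ hy
  have x3 := mul_inv_cancel₀ hx
  have x4 := inv_mul_cancel₀ hx
  have y3 := mul_inv_cancel₀ hy
  have y4 := inv_mul_cancel₀ hy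
  subst ha ha' ht hu hθ hφ hE hg
  refine ⟨?_, ?_, ?_, ?_, ?_, ?_, ?_, ?_, ?_, ?_, ?_, ?_⟩
  all_goals
    simp only [mul_add, add_mul, mul_sub, sub_mul, mul_assoc, smul_mul_assoc, mul_smul_comm,
      smul_add, smul_sub, smul_smul, neg_mul, mul_neg, neg_neg, smul_neg,
      h, r2, r3, r4, a1, a2, a3, a4, x1, x2, y1, y2, x3, x4, y3, y4, mul_one, one_mul]
    match_scalars <;> grind

set_option linter.unusedSimpArgs false in
set_option maxHeartbeats 1000000 in
theorem cubic_commutation (hq : q ≠ 0) (hω : ω ^ 2 + ω + 1 = 0) (hω1 : ω ≠ 1)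
    (h : x * y = q • (y * x)) (hx : x ≠ 0) (hy : y ≠ 0) {a a' θ φ : D}
    (ha : a = -y - x * y⁻¹ + x⁻¹) (ha' : a' = -y⁻¹ - y * x⁻¹ + x)
    (hθ : θ = -y - ω ^ 2 • (x * y⁻¹) + ω • x⁻¹) (hφ : φ = -y⁻¹ - ω ^ 2 • (y * x⁻¹) + ω • x)
    {β β' : k} (hβ : β * (q * (1 - ω)) = ω ^ 2 * (1 - q ^ 2))
    (hβ' : β' * (q * (1 - ω)) = 1 - ω * q ^ 2) :
    φ * a = (q - β * ω ^ 2) • (a * φ) + β • (θ * a') ∧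
    a' * θ = (ω ^ 2 * (q - β')) • (a * φ) + β' • (θ * a') ∧
    ∃ c c' : k, a * φ = c • (φ * a) + c' • (a' * θ) := by
  obtain ⟨e, he⟩ : ∃ e, e = y * x⁻¹ * y - ω ^ 2 • (x * (x * y⁻¹)) - ω • (y⁻¹ * x⁻¹) := ⟨_, rfl⟩
  obtain ⟨g, hg⟩ : ∃ g, g = x * y⁻¹ * y⁻¹ - ω ^ 2 • (x⁻¹ * (y * x⁻¹)) - ω • (y * x) := ⟨_, rfl⟩
  have key : a * φ = (q * ω ^ 2) • e + g ∧ φ * a = ω ^ 2 • e + q • g ∧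
      a' * θ = e + (q * ω ^ 2) • g ∧ θ * a' = q • e + ω ^ 2 • g := by
    have r2 := mul_inv_rel h hq hy
    have r3 := inv_mul_rel h hq hx
    have r4 := inv_mul_inv_rel h hq hx hy
    have a1 := mul_mul_of_rel h
    have a2 := mul_mul_of_rel r2
    have a3 := mul_mul_of_rel r3
    have a4 := mul_mul_of_rel r4
    have x1 := mul_inv_cancel_left₀ hx
    have x2 := inv_mul_cancel_left₀ hx
    have y1 := mul_inv_cancel_left₀ hy
    have y2 := inv_mul_cancel_left₀ hy
    have x3 := mul_inv_cancel₀ hx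
    have x4 := inv_mul_cancel₀ hx
    have y3 := mul_inv_cancel₀ hy
    have y4 := inv_mul_cancel₀ hy
    subst ha ha' hθ hφ he hg
    clear hβ hβ'
    refine ⟨?_, ?_, ?_, ?_⟩
    all_goals
      simp only [mul_add, add_mul, mul_sub, sub_mul, mul_assoc, smul_mul_assoc, mul_smul_comm,
        smul_add, smul_sub, smul_smul, neg_mul, mul_neg, neg_neg, smul_neg,
        h, r2, r3, r4, a1, a2, a3, a4, x1, x2, y1, y2, x3, x4, y3, y4, mul_one, one_mul]
      match_scalars <;> grind
  obtain ⟨k1, k2, k3, k4⟩ := key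
  rw [k1, k2, k3, k4]
  have hω1' : 1 - ω ≠ 0 := sub_ne_zero.2 hω1.symm
  have hd : q * (ω - 1) ≠ 0 := mul_ne_zero hq (sub_ne_zero.2 hω1)
  refine ⟨?_, ?_, (q ^ 2 * ω - 1) * (q * (ω - 1))⁻¹, (ω ^ 2 - q ^ 2 * ω ^ 2 ) * (q * (ω - 1))⁻¹, ?_⟩
  · match_scalars <;> grind
  · match_scalars <;> grind
  · match_scalars <;> grind

end Cubic

section CubicGenerators

variable {k D : Type*} [Field k] [DivisionRing D] [Algebra k D] {q ω δ : k}

set_option linter.unusedSimpArgs false in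
set_option maxHeartbeats 4000000 in
theorem cubic_generator_relations (hq : q ≠ 0) (hω : ω ^ 2 + ω + 1 = 0)
    (hδ : δ * (ω - ω ^ 2) = 1) {a a' h E g G H : D}
    (h1 : a * h = (q - (1 - q ^ 2) * q⁻¹ * δ * ω ^ 2) • (h * a) +
      ((1 - q ^ 2) * q⁻¹ * δ) • (h * (h * a')) +
      ((1 - q ^ 2) * q⁻¹ * δ * ((ω ^ 2 - ω) * (1 - q))) • (h * (h * h)) -
      ((ω - ω ^ 2) * (1 - q⁻¹)) • 1)
    (h2 : a' * h = (ω ^ 2 * (q - (1 - ω * q ^ 2) * q⁻¹ * ω * δ)) • a +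
      ((1 - ω * q ^ 2) * q⁻¹ * ω * δ) • (h * a') +
      ((1 - ω * q ^ 2) * q⁻¹ * ω * δ * ((ω ^ 2 - ω) * (1 - q))) • (h * h))
    (h3 : a * a = (3 : k) • h + ω ^ 2 • (h * E) + (q * ω) • (h * g) +
      (1 + q⁻¹ - ω ^ 2 - q⁻¹ * ω) • a')
    (h4 : a * a' = (3 : k) • 1 + q • E + g)
    (h5 : a' * a = (3 : k) • 1 + E + q • g)
    (h6 : h * (a' * a') = (3 : k) • 1 + (q * ω) • E + ω ^ 2 • g -
      (ω + q * ω ^ 2 - 1 - q) • (h * a))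
    (hG : G = (-δ) • (h * (h * a') - ω • (h * a)) - q • (h * (h * h)) - (ω * q⁻¹) • 1)
    (hH : H = δ • (h * (h * a') - ω ^ 2 • (h * a)) - h * (h * h) - ω ^ 2 • 1) :
    h * H = q • (H * h) ∧
    G * H = q ^ 4 • (h * (h * (h * (h * (h * h))))) + (q + q ^ 2) • (h * (h * h)) +
      q⁻¹ • 1 := by
  have a1 (r : D) := congrArg (· * r) h1
  have a2 (r : D) := congrArg (· * r) h2
  simp only [add_mul, sub_mul, smul_mul_assoc, mul_assoc, one_mul] at a1 a2
  subst hG hH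
  constructor
  · simp only [mul_add, add_mul, mul_sub, sub_mul, mul_assoc, smul_mul_assoc, mul_smul_comm,
      smul_add, smul_sub, smul_smul, neg_mul, mul_neg, neg_neg, smul_neg,
      h1, h2, a1, a2, mul_one, one_mul]
    match_scalars <;> grind
  · simp only [mul_add, add_mul, mul_sub, sub_mul, mul_assoc, smul_mul_assoc, mul_smul_comm,
      smul_add, smul_sub, smul_smul, neg_mul, mul_neg, neg_neg, smul_neg,
      h1, h2, a1, a2, mul_one, one_mul]
    simp only [mul_add, add_mul, mul_sub, sub_mul, mul_assoc, smul_mul_assoc, mul_smul_comm,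
      smul_add, smul_sub, smul_smul, h3, h4, h5, h6, mul_one, one_mul]
    match_scalars
    all_goals grind

end CubicGenerators

section CubicFixed

open WithZero

variable {k D : Type*} [Field k] [DivisionRing D] [Algebra k D] {x y : D} {q ω : k}

theorem valuation_of_eq_smul_add {v : Valuation D (WithZero (Multiplicative (ℤ ×ₗ ℤ)))}
    (hv : ∀ c : k, c ≠ 0 → v (algebraMap k D c) = 1) {c : k} (hc : c ≠ 0) {d f r : D}
    {γ : ℤ ×ₗ ℤ} (hd : d = c • f + r) (hf : v f = exp γ) (hr : v r < exp γ) : v d = exp γ := by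
  rw [hd, ← hf, ← valuation_smul hv hc f]
  refine v.map_add_eq_of_lt_left ?_
  rwa [valuation_smul hv hc, hf]

theorem valuation_smul_le {v : Valuation D (WithZero (Multiplicative (ℤ ×ₗ ℤ)))}
    (hv : ∀ c : k, c ≠ 0 → v (algebraMap k D c) = 1) (c : k) (d : D) : v (c • d) ≤ v d := by
  obtain rfl | hc := eq_or_ne c 0
  · rw [zero_smul, map_zero]
    exact zero_le
  · exact (valuation_smul hv hc d).le

theorem valuation_smul_add_smul_lt {v : Valuation D (WithZero (Multiplicative (ℤ ×ₗ ℤ)))}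
    (hv : ∀ c : k, c ≠ 0 → v (algebraMap k D c) = 1) (c c' : k) {d d' : D} {α α' γ : ℤ ×ₗ ℤ}
    (hd : v d = exp α) (hd' : v d' = exp α') (h : α < γ) (h' : α' < γ) :
    v (c • d + c' • d') < exp γ :=
  v.map_add_lt ((valuation_smul_le hv c d).trans_lt (by rwa [hd, exp_lt_exp]))
    ((valuation_smul_le hv c' d').trans_lt (by rwa [hd', exp_lt_exp]))

/-- The fixed ring of the order-3 automorphism `x ↦ -y⁻¹`, `y ↦ xy⁻¹` is a `q`-division ring. -/
theorem exists_range_eq_fixed_cubic [CharZero k] (hD : IsQDivisionRing k D q x y) (hq : q ≠ 0)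
    (hω : IsPrimitiveRoot ω 3) (σ : D →ₐ[k] D) (hσx : σ x = -y⁻¹) (hσy : σ y = x * y⁻¹) :
    ∃ F : D →ₐ[k] D, Set.range F = {d | σ d = d} := by
  have hx := hD.x_ne_zero
  have hy := hD.y_ne_zero
  have hω0 : ω ≠ 0 := hω.ne_zero (by decide)
  have hω1 : ω ≠ 1 := hω.ne_one (by decide)
  have hω2 : ω ^ 2 + ω + 1 = 0 := by
    have h := hω.pow_eq_one
    refine (mul_eq_zero.1 (?_ : (ω - 1) * _ = 0)).resolve_left (sub_ne_zero.2 hω1)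
    linear_combination h
  have hω3 : ω - ω ^ 2 ≠ 0 := by
    rw [show ω - ω ^ 2 = ω * (1 - ω) by ring]
    exact mul_ne_zero hω0 (sub_ne_zero.2 hω1.symm)
  obtain ⟨δ, hδ⟩ : ∃ δ, δ * (ω - ω ^ 2) = 1 := ⟨_, inv_mul_cancel₀ hω3⟩
  have hδ0 : δ ≠ 0 := left_ne_zero_of_mul_eq_one hδ
  obtain ⟨v, hvx, hvy, hvk⟩ := exists_valuation hD hq
  obtain ⟨a, ha⟩ : ∃ a, a = -y - x * y⁻¹ + x⁻¹ := ⟨_, rfl⟩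
  obtain ⟨a', ha'⟩ : ∃ a', a' = -y⁻¹ - y * x⁻¹ + x := ⟨_, rfl⟩
  obtain ⟨t, ht⟩ : ∃ t, t = -y - ω • (x * y⁻¹) + ω ^ 2 • x⁻¹ := ⟨_, rfl⟩
  obtain ⟨u, hu⟩ : ∃ u, u = -y⁻¹ - ω • (y * x⁻¹) + ω ^ 2 • x := ⟨_, rfl⟩
  obtain ⟨θ, hθ⟩ : ∃ θ, θ = -y - ω ^ 2 • (x * y⁻¹) + ω • x⁻¹ := ⟨_, rfl⟩
  obtain ⟨φ, hφ⟩ : ∃ φ, φ = -y⁻¹ - ω ^ 2 • (y * x⁻¹) + ω • x := ⟨_, rfl⟩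
  have hvxi : v x⁻¹ = exp (toLex (0, -1)) := by
    rw [map_inv₀, hvx, ← exp_neg]
    rfl
  have hvyi : v y⁻¹ = exp (toLex (-1, 0)) := by
    rw [map_inv₀, hvy, ← exp_neg]
    rfl
  have hvxy : v (x * y⁻¹) = exp (toLex (-1, 1)) := by
    rw [map_mul, hvx, hvyi, ← exp_add]
    rfl
  have hvyx : v (y * x⁻¹) = exp (toLex (1, -1)) := by
    rw [map_mul, hvy, hvxi, ← exp_add]
    rfl
  have hvt : v t = exp (toLex (1, 0)) := by
    refine valuation_of_eq_smul_add hvk (c := -1) (neg_ne_zero.2 one_ne_zero)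
      (r := (-ω) • (x * y⁻¹) + ω ^ 2 • x⁻¹) ?_ hvy
      (valuation_smul_add_smul_lt hvk _ _ hvxy hvxi (by decide) (by decide))
    rw [ht]
    module
  have hvθ : v θ = exp (toLex (1, 0)) := by
    refine valuation_of_eq_smul_add hvk (c := -1) (neg_ne_zero.2 one_ne_zero)
      (r := (-ω ^ 2) • (x * y⁻¹) + ω • x⁻¹) ?_ hvy
      (valuation_smul_add_smul_lt hvk _ _ hvxy hvxi (by decide) (by decide))
    rw [hθ]
    module
  have hvφ : v φ = exp (toLex (1, -1)) := by
    refine valuation_of_eq_smul_add hvk (c := -ω ^ 2) (neg_ne_zero.2 (pow_ne_zero 2 hω0))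
      (r := (-1 : k) • y⁻¹ + ω • x) ?_ hvyx
      (valuation_smul_add_smul_lt hvk _ _ hvyi hvx (by decide) (by decide))
    rw [hφ]
    module
  have ht0 := ne_zero_of_valuation hvt
  have hθ0 := ne_zero_of_valuation hvθ
  have hφ0 := ne_zero_of_valuation hvφ
  obtain ⟨i1, i2, i3, i4, i5, i6, i7, i8, i9, i10, i11, i12⟩ :=
    cubic_identities hq hω2 hD.rel_smul hx hy ha ha' ht hu hθ hφ rfl rfl
  obtain ⟨c1, c2, c, c', c3⟩ := cubic_commutation (β := (1 - q ^ 2) * q⁻¹ * δ)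
    (β' := (1 - ω * q ^ 2) * q⁻¹ * ω * δ) hq hω2 hω1 hD.rel_smul hx hy ha ha' hθ hφ
    (by grind) (by grind)
  obtain ⟨h, hh⟩ : ∃ h, h = θ * φ⁻¹ := ⟨_, rfl⟩
  have hhφ : h * φ = θ := by rw [hh, inv_mul_cancel_right₀ hφ0]
  have hvh : v h = exp (toLex (0, 1)) := by
    rw [hh, map_mul, map_inv₀, hvθ, hvφ, ← exp_neg, ← exp_add]
    rfl
  have hh0 := ne_zero_of_valuation hvh
  have r2 : a' * h = (ω ^ 2 * (q - (1 - ω * q ^ 2) * q⁻¹ * ω * δ)) • a +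
      ((1 - ω * q ^ 2) * q⁻¹ * ω * δ) • (h * a') +
      ((1 - ω * q ^ 2) * q⁻¹ * ω * δ * ((ω ^ 2 - ω) * (1 - q))) • (h * h) := by
    rw [← mul_left_inj' hφ0, mul_assoc a', hhφ, c2, ← hhφ, mul_assoc h φ a', i2, ← hhφ]
    simp only [add_mul, mul_add, smul_mul_assoc, mul_smul_comm, mul_assoc]
    module
  have r1 : a * h = (q - (1 - q ^ 2) * q⁻¹ * δ * ω ^ 2) • (h * a) +
      ((1 - q ^ 2) * q⁻¹ * δ) • (h * (h * a')) +
      ((1 - q ^ 2) * q⁻¹ * δ * ((ω ^ 2 - ω) * (1 - q))) • (h * (h * h)) -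
      ((ω - ω ^ 2) * (1 - q⁻¹)) • 1 := by
    have e : h * (φ * a) = a * h * φ + ((ω - ω ^ 2) * (1 - q⁻¹)) • φ := by
      rw [← mul_assoc, hhφ, i1, mul_assoc, hhφ]
    rw [← mul_left_inj' hφ0, eq_sub_of_add_eq e.symm, c1, ← hhφ, mul_assoc h φ a', i2, ← hhφ]
    simp only [add_mul, sub_mul, mul_add, smul_mul_assoc, mul_smul_comm, mul_assoc, one_mul]
    module
  obtain ⟨E, hE⟩ : ∃ E, E = y * x⁻¹ * y - x * (x * y⁻¹) - y⁻¹ * x⁻¹ := ⟨_, rfl⟩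
  obtain ⟨g, hg⟩ : ∃ g, g = x * y⁻¹ * y⁻¹ - x⁻¹ * (y * x⁻¹) - y * x := ⟨_, rfl⟩
  rw [← hE, ← hg] at i9 i10 i11 i12
  have r3 : a * a = (3 : k) • h + ω ^ 2 • (h * E) + (q * ω) • (h * g) +
      (1 + q⁻¹ - ω ^ 2 - q⁻¹ * ω) • a' := by
    rw [i3, ← hhφ, mul_assoc, i11]
    simp only [mul_add, mul_smul_comm, mul_one]
  have r6 : h * (a' * a') = (3 : k) • 1 + (q * ω) • E + ω ^ 2 • g -
      (ω + q * ω ^ 2 - 1 - q) • (h * a) := by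
    rw [← i12, ← hhφ, mul_assoc, i6, mul_add, mul_smul_comm, add_sub_cancel_right]
  obtain ⟨G, hG⟩ : ∃ G, G = (-δ) • (h * (h * a') - ω • (h * a)) - q • (h * (h * h)) -
    (ω * q⁻¹) • 1 := ⟨_, rfl⟩
  obtain ⟨H, hH⟩ : ∃ H, H = δ • (h * (h * a') - ω ^ 2 • (h * a)) - h * (h * h) - ω ^ 2 • 1 :=
    ⟨_, rfl⟩
  obtain ⟨hrel, hGH⟩ := cubic_generator_relations hq hω2 hδ r1 r2 r3 i9 i10 r6 hG hH
  have hvH : v H = exp (toLex (1, 1)) := by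
    have hvP : v ((ω - ω ^ 2) • y + (1 - ω ^ 2) • (x * y⁻¹)) = exp (toLex (1, 0)) := by
      refine valuation_of_eq_smul_add hvk hω3 rfl hvy ?_
      refine (valuation_smul_le hvk _ _).trans_lt ?_
      rw [hvxy, exp_lt_exp]
      decide
    have hvR : v ((ω - 1) • y⁻¹ + (1 - ω ^ 2) • x) < exp (toLex (0, 2)) :=
      valuation_smul_add_smul_lt hvk _ _ hvyi hvx (by decide) (by decide)
    have hvh3 : v (h * (h * h)) = exp (toLex (0, 3)) := by
      rw [map_mul, map_mul, hvh, ← exp_add, ← exp_add]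
      rfl
    have hvhP : v (h * ((ω - ω ^ 2) • y + (1 - ω ^ 2) • (x * y⁻¹))) = exp (toLex (1, 1)) := by
      rw [map_mul, hvh, hvP, ← exp_add]
      rfl
    refine valuation_of_eq_smul_add hvk (neg_ne_zero.2 hδ0)
      (r := δ • (h * (h * ((ω - 1) • y⁻¹ + (1 - ω ^ 2) • x))) +
        ((-1 : k) • (h * (h * h)) + (-ω ^ 2) • 1)) ?_ hvhP (v.map_add_lt ?_ ?_)
    · have e : h * a' = ω • θ + h * ((ω - 1) • y⁻¹ + (1 - ω ^ 2) • x) := by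
        rw [← hhφ, ha', hφ]
        simp only [mul_add, mul_sub, mul_smul_comm, mul_neg]
        match_scalars <;> grind
      rw [hH, e, hθ, ha]
      simp only [mul_add, mul_sub, mul_smul_comm, mul_neg]
      match_scalars <;> grind
    · refine (valuation_smul_le hvk _ _).trans_lt ?_
      rw [map_mul, map_mul, hvh, ← mul_assoc, ← exp_add]
      calc _ < exp (toLex ((0 : ℤ), (1 : ℤ)) + toLex (0, 1)) * exp (toLex (0, 2)) :=
            (mul_lt_mul_iff_right₀ exp_pos).2 hvR
        _ < _ := by
            rw [← exp_add, exp_lt_exp]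
            decide
    · refine valuation_smul_add_smul_lt hvk _ _ hvh3 (d' := 1) (α' := 0) ?_ (by decide) (by decide)
      rw [map_one, exp_zero]
  have hH0 := ne_zero_of_valuation hvH
  have hli : LinearIndependent k (mon h H) := by
    refine linearIndependent_mon_of_valuation v hvk hvh hvH ?_
    rintro ⟨a, b⟩ ⟨c, d⟩ h
    have := congrArg ofLex h
    simp [Prod.ext_iff] at this
    simp
    omega
  obtain ⟨F, hFx, hFy⟩ := exists_algHom hD hrel hli
  refine ⟨F, ?_⟩
  have hk : ∀ c : k, algebraMap k D c ∈ (F : D →+* D).fieldRange := fun c =>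
    ⟨algebraMap k D c, F.commutes c⟩
  have hhL : h ∈ (F : D →+* D).fieldRange := ⟨x, hFx⟩
  have hHL : H ∈ (F : D →+* D).fieldRange := ⟨y, hFy⟩
  have h1L : (1 : D) ∈ (F : D →+* D).fieldRange := one_mem _
  have hsm {c : k} {d : D} (hd : d ∈ (F : D →+* D).fieldRange) :
    c • d ∈ (F : D →+* D).fieldRange := smul_mem_of_algebraMap_mem hk c hd
  have hh3L := mul_mem hhL (mul_mem hhL hhL)
  have hGL : G ∈ (F : D →+* D).fieldRange := by
    rw [(eq_mul_inv_iff_mul_eq₀ hH0).2 hGH]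
    exact mul_mem (add_mem (add_mem (hsm (mul_mem hhL (mul_mem hhL (mul_mem hhL hh3L))))
      (hsm hh3L)) (hsm h1L)) (inv_mem hHL)
  have haL : a ∈ (F : D →+* D).fieldRange := by
    refine mem_of_mul_mem hhL hh0 ?_
    have e : h * a = G + H + (1 + q) • (h * (h * h)) + (ω * q⁻¹ + ω ^ 2) • 1 := by
      rw [hG, hH]
      match_scalars <;> grind
    rw [e]
    exact add_mem (add_mem (add_mem hGL hHL) (hsm hh3L)) (hsm h1L)
  have ha'L : a' ∈ (F : D →+* D).fieldRange := by
    refine mem_of_mul_mem hhL hh0 (mem_of_mul_mem hhL hh0 ?_)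
    have e : h * (h * a') = (ω - ω ^ 2) • (H + h * (h * h) + ω ^ 2 • 1) + ω ^ 2 • (h * a) := by
      rw [hH]
      match_scalars <;> grind
    rw [e]
    exact add_mem (hsm (add_mem (add_mem hHL hh3L) (hsm h1L))) (hsm (mul_mem hhL haL))
  have huφL : u * φ ∈ (F : D →+* D).fieldRange := by
    rw [i5]
    exact add_mem (mul_mem ha'L ha'L) (hsm haL)
  have htθL : t * θ ∈ (F : D →+* D).fieldRange := by
    rw [i4]
    exact add_mem (mul_mem haL haL) (hsm ha'L)
  have htφL : t * φ ∈ (F : D →+* D).fieldRange := by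
    have e : t * φ = (9 : k) • 1 - a * a' - h * (φ * u) := by
      rw [← i7, ← mul_assoc, hhφ]
      abel
    rw [e, i6]
    exact sub_mem (sub_mem (hsm h1L) (mul_mem haL ha'L))
      (mul_mem hhL (add_mem (mul_mem ha'L ha'L) (hsm haL)))
  have htφ0 : t * φ ≠ 0 := mul_ne_zero ht0 hφ0
  obtain ⟨ψ, hψ⟩ : ∃ ψ, ψ = φ⁻¹ * h * φ := ⟨_, rfl⟩
  have hφψ : φ * ψ = θ := by rw [hψ, mul_assoc, mul_inv_cancel_left₀ hφ0, hhφ]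
  have hψL : ψ ∈ (F : D →+* D).fieldRange := by
    refine mem_of_mul_mem htφL htφ0 ?_
    rwa [mul_assoc, hφψ]
  have ha'ψ : φ⁻¹ * a' * φ = a' - ((ω ^ 2 - ω) * (1 - q)) • ψ := by
    rw [mul_assoc, ← sub_eq_of_eq_add i2, ← hφψ, ← mul_smul_comm, ← mul_sub,
      inv_mul_cancel_left₀ hφ0]
  have ha'φL : φ⁻¹ * a' * φ ∈ (F : D →+* D).fieldRange := ha'ψ ▸ sub_mem ha'L (hsm hψL)
  have haφL : φ⁻¹ * a * φ ∈ (F : D →+* D).fieldRange := by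
    have e : φ⁻¹ * a * φ = c • a + c' • (φ⁻¹ * a' * φ * ψ) := by
      rw [mul_assoc, c3, mul_add, mul_smul_comm, mul_smul_comm, inv_mul_cancel_left₀ hφ0,
        mul_assoc, hφψ, mul_assoc]
    rw [e]
    exact add_mem (hsm haL) (hsm (mul_mem ha'φL hψL))
  have hφ3L : φ ^ 3 ∈ (F : D →+* D).fieldRange := by
    refine mem_of_mul_mem hhL hh0 ?_
    have e : h * φ ^ 3 = -(a * (u * φ)) - t * φ * (φ⁻¹ * a' * φ) := by
      have := congrArg (· * φ) i8
      simp only [add_mul, zero_mul, mul_assoc] at this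
      rw [pow_three, ← mul_assoc, hhφ, mul_assoc, mul_assoc, mul_inv_cancel_left₀ hφ0]
      rw [eq_sub_iff_add_eq, eq_neg_iff_add_eq_zero, ← this]
      abel
    rw [e]
    exact sub_mem (neg_mem (mul_mem haL huφL)) (mul_mem htφL ha'φL)
  have hσa : σ a = a := by
    rw [ha]
    simp only [map_sub, map_add, map_neg, map_mul, map_inv₀, hσx, hσy, mul_inv_rev, inv_inv,
      inv_neg, neg_mul, inv_mul_cancel_left₀ hy]
    abel
  have hσa' : σ a' = a' := by
    rw [ha']
    simp only [map_sub, map_add, map_neg, map_mul, map_inv₀, hσx, hσy, mul_inv_rev, inv_inv,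
      inv_neg, mul_neg, inv_mul_cancel_right₀ hy]
    abel
  have hσθ : σ θ = ω • θ := by
    rw [hθ]
    simp only [map_sub, map_add, map_neg, map_mul, map_inv₀, map_smul, hσx, hσy, mul_inv_rev,
      inv_inv, inv_neg, neg_mul, inv_mul_cancel_left₀ hy]
    match_scalars <;> grind
  have hσφ : σ φ = ω • φ := by
    rw [hφ]
    simp only [map_sub, map_add, map_neg, map_mul, map_inv₀, map_smul, hσx, hσy, mul_inv_rev,
      inv_inv, inv_neg, mul_neg, inv_mul_cancel_right₀ hy]
    match_scalars <;> grind
  have hσφi : σ φ⁻¹ = ω⁻¹ • φ⁻¹ := by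
    rw [map_inv₀, hσφ]
    refine inv_eq_of_mul_eq_one_right ?_
    rw [smul_mul_smul_comm, mul_inv_cancel₀ hω0, mul_inv_cancel₀ hφ0, one_smul]
  have hσh : σ h = h := by
    rw [hh, map_mul, hσθ, hσφi, smul_mul_smul_comm, mul_inv_cancel₀ hω0, one_smul]
  refine range_eq_fixed hD F σ (n := 3) (by norm_num) hω.inv
    (inv_ne_zero hφ0) hσφi ?_ ?_ ?_ ?_ ?_ ?_
  · rw [hFx, hσh]
  · rw [hFy, hH]
    simp only [map_sub, map_smul, map_mul, map_one, hσh, hσa, hσa']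
  · rw [inv_pow]
    exact inv_mem hφ3L
  · rwa [hFx, inv_inv, ← hψ]
  · have e : φ⁻¹ * H * φ = δ • (ψ * (ψ * (φ⁻¹ * a' * φ)) - ω ^ 2 • (ψ * (φ⁻¹ * a * φ))) -
        ψ * (ψ * ψ) - ω ^ 2 • 1 := by
      rw [hH, hψ]
      simp only [mul_sub, sub_mul, mul_smul_comm, smul_mul_assoc, mul_assoc, mul_one,
        mul_inv_cancel_left₀ hφ0, inv_mul_cancel₀ hφ0]
    rw [hFy, inv_inv, e]
    exact sub_mem (sub_mem (hsm (sub_mem (mul_mem hψL (mul_mem hψL ha'φL))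
      (hsm (mul_mem hψL haφL)))) (mul_mem hψL (mul_mem hψL hψL))) (hsm h1L)
  · intro S hLS hρ
    have hsS {c : k} {d : D} (hd : d ∈ S) : c • d ∈ S :=
      smul_mem_of_algebraMap_mem (fun c => hLS (hk c)) c hd
    have hφS : φ ∈ S := by
      rw [← inv_inv φ]
      exact inv_mem hρ
    have hθS : θ ∈ S := by
      rw [← hhφ]
      exact mul_mem (hLS hhL) hφS
    have huS : u ∈ S := by
      rw [← mul_inv_cancel_right₀ hφ0 u]
      exact mul_mem (hLS huφL) hρ
    have htS : t ∈ S := by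
      rw [← mul_inv_cancel_right₀ hθ0 t]
      exact mul_mem (hLS htθL) (inv_mem hθS)
    have ex : x = (3⁻¹ : k) • (a' + ω • u + ω ^ 2 • φ) := by
      rw [ha', hu, hφ]
      match_scalars <;> grind
    have ey : y = (-3⁻¹ : k) • (a + t + θ) := by
      rw [ha, ht, hθ]
      match_scalars <;> grind
    constructor
    · rw [ex]
      exact hsS (add_mem (add_mem (hLS ha'L) (hsS huS)) (hsS hφS))
    · rw [ey]
      exact hsS (add_mem (add_mem (hLS haL) htS) hθS)

end CubicFixed

section FixedRing

variable {k D : Type*} [Field k] [DivisionRing D] [Algebra k D] {x y : D}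

theorem exists_restrict_algHom {F τ : D →ₐ[k] D} (h : ∀ d, τ (F d) ∈ F.range) :
    ∃ σ : D →ₐ[k] D, ∀ d, F (σ d) = τ (F d) := by
  let e := AlgEquiv.ofInjective F (F : D →+* D).injective
  refine ⟨(e.symm : F.range →ₐ[k] D).comp ((τ.comp F).codRestrict F.range h), fun d => ?_⟩
  exact congrArg Subtype.val (e.apply_symm_apply ⟨τ (F d), h d⟩)

theorem exists_range_eq_fixed [CharZero k] {ω s : k} (hs : s ≠ 0) (hω : IsPrimitiveRoot ω 3)
    (hD : IsQDivisionRing k D (s ^ 2) x y) (η : D →ₐ[k] D) (hηx : η x = y⁻¹)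
    (hηy : η y = s • (y * x)) : ∃ F : D →ₐ[k] D, Set.range F = {d | η d = d} := by
  have hx := hD.x_ne_zero
  have hy := hD.y_ne_zero
  have hyx : s ^ 2 • (y * (x * y⁻¹)) = x := by
    rw [← mul_assoc, ← smul_mul_assoc, ← hD.rel_smul, mul_inv_cancel_right₀ hy]
  have hinv : (s • (y * x))⁻¹ = s • (y⁻¹ * x⁻¹) := by
    refine inv_eq_of_mul_eq_one_right ?_
    rw [smul_mul_smul_comm, ← pow_two, ← mul_assoc, mul_assoc y, ← smul_mul_assoc, hyx,
      mul_inv_cancel₀ hx]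
  have hη2 : η (η y) = x := by
    rw [hηy, map_smul, map_mul, hηx, hηy, smul_mul_assoc, smul_smul, ← pow_two, mul_assoc, hyx]
  have hη3y : η (η (η y)) = y⁻¹ := by rw [hη2, hηx]
  have hη3x : η (η (η x)) = x⁻¹ := by rw [hηx, map_inv₀, map_inv₀, hη2]
  obtain ⟨F, hFx, hFy, hF⟩ := exists_range_eq_fixed_inversion hD hs (η.comp (η.comp η)) hη3x hη3y
  have hinj : Function.Injective F := (F : D →+* D).injective
  have hmem (d : D) : η (F d) ∈ F.range := by
    have h1 : F d ∈ Set.range F := ⟨d, rfl⟩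
    have h2 : η (F d) ∈ Set.range F := by
      rw [hF] at h1 ⊢
      exact congrArg η h1
    exact h2
  obtain ⟨σ, hσ⟩ := exists_restrict_algHom hmem
  have hX₁ : η (x - x⁻¹) = -(y - y⁻¹) := by rw [map_sub, map_inv₀, hηx, inv_inv, neg_sub]
  have hX₂ : η (y - y⁻¹) = s • (y * x) - s • (y⁻¹ * x⁻¹) := by
    rw [map_sub, map_inv₀, hηy, hinv]
  have hX₃ : η (s • (y * x) - s • (y⁻¹ * x⁻¹)) = x - x⁻¹ := by
    rw [← hX₂, map_sub, map_sub, map_inv₀, map_inv₀, hη2]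
  have hX₂0 : y - y⁻¹ ≠ 0 := fun h => by
    rw [h, inv_zero, mul_zero, map_eq_zero] at hFx
    exact hx hFx
  have hσx : σ x = -y⁻¹ := by
    apply hinj
    rw [hσ, map_neg, map_inv₀, hFx, hFy, map_mul, map_inv₀, hX₁, hX₂, mul_inv_rev, inv_inv,
      neg_mul]
  have hσy : σ y = x * y⁻¹ := by
    apply hinj
    rw [hσ, map_mul, map_inv₀, hFx, hFy, map_mul, map_inv₀, hX₂, hX₃, mul_inv_rev, inv_inv,
      mul_assoc, inv_mul_cancel_left₀ hX₂0]
  obtain ⟨F', hF'⟩ := exists_range_eq_fixed_cubic hD (pow_ne_zero 2 hs) hω σ hσx hσy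
  refine ⟨F.comp F', Set.ext fun d => ⟨?_, fun hd => ?_⟩⟩
  · rintro ⟨e, rfl⟩
    have h1 : F' e ∈ Set.range F' := ⟨e, rfl⟩
    rw [hF'] at h1
    exact (hσ (F' e)).symm.trans (congrArg F h1)
  · have hd : η d = d := hd
    have h1 : d ∈ Set.range F := by
      rw [hF]
      exact (congrArg (fun d => η (η d)) hd).trans ((congrArg η hd).trans hd)
    obtain ⟨e, rfl⟩ := h1
    have h2 : e ∈ Set.range F' := by
      rw [hF']
      exact hinj ((hσ e).trans hd)
    obtain ⟨e', rfl⟩ := h2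
    exact ⟨e', rfl⟩

end FixedRing

end QDivision

/-- Suppose `k` contains a primitive third root of unity, a square root `q̂` of `q` and a cube
root `p` of `q`, and let `η` be the order-6 automorphism of `D` with `η(x) = y⁻¹`,
`η(y) = q̂yx`.  Then the fixed ring `D^η = {r ∈ D : η(r) = r}` is isomorphic to `D = k_q(x,y)`
as a `k`-algebra (for the same `q`): there is an injective `k`-algebra endomorphism of `D`
whose range is exactly `D^η`. -/
theorem stmt12 (k : Type*) [Field k] [CharZero k] (q : k) (hq : q ≠ 0)
    (ω : k) (hω : IsPrimitiveRoot ω 3) (qh : k) (hqh : qh ^ 2 = q)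
    (p : k) (hp : p ^ 3 = q)
    (D : Type*) [DivisionRing D] [Algebra k D] (x y : D)
    (hD : IsQDivisionRing k D q x y)
    (η : D ≃ₐ[k] D) (hηx : η x = y⁻¹)
    (hηy : η y = algebraMap k D qh * (y * x)) :
    ∃ F : D →ₐ[k] D, Function.Injective F ∧
      Set.range F = {r : D | η r = r} := by
  subst hqh
  have hs : qh ≠ 0 := fun h => hq (by rw [h, zero_pow two_ne_zero])
  obtain ⟨F, hF⟩ := QDivision.exists_range_eq_fixed hs hω hD (η : D →ₐ[k] D) hηx
    (hηy.trans (Algebra.smul_def _ _).symm)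
  exact ⟨F, (F : D →+* D).injective, hF⟩
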